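/- arXiv:2508.09548 — 5 statements merged into one kernel-verified Lean document; each statement's English description precedes it below -/
import Mathlib

section
/- Let f : ℂ → ℂ be a nonconstant entire function, and let a₁, a₂, a₃ be three pairwise distinct complex numbers such that f partially shares each aₖ (k = 1,2,3) with its derivative f'. Then f' = f identically on ℂ. -/
open Filter Topology

/-- The weight `(1 + |w|^{1/4}) / |w|^{7/4}`, whose logarithm is strictly subharmonic
away from the origin. -/
noncomputable def singularWeight (w : ℂ) : ℝ :=
  (1 + ‖w‖ ^ (1 / 4 : ℝ)) / (‖w‖ ^ (1 / 4 : ℝ)) ^ 7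

lemma norm_rpow_quarter_pow (w : ℂ) : (‖w‖ ^ (1 / 4 : ℝ)) ^ 4 = ‖w‖ := by
  rw [← Real.rpow_natCast, ← Real.rpow_mul (norm_nonneg w)]
  norm_num

lemma singularWeight_nonneg (w : ℂ) : 0 ≤ singularWeight w := by
  unfold singularWeight; positivity

lemma singularWeight_pos {w : ℂ} (hw : w ≠ 0) : 0 < singularWeight w := by
  have : 0 < ‖w‖ := norm_pos_iff.2 hw
  unfold singularWeight; positivity

lemma continuousAt_singularWeight {w : ℂ} (hw : w ≠ 0) : ContinuousAt singularWeight w := by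
  have h : ContinuousAt (fun w : ℂ ↦ ‖w‖ ^ (1 / 4 : ℝ)) w :=
    continuous_norm.continuousAt.rpow_const (Or.inr (by norm_num))
  have hx : 0 < ‖w‖ ^ (1 / 4 : ℝ) := Real.rpow_pos_of_pos (norm_pos_iff.2 hw) _
  exact (continuousAt_const.add h).div (h.pow 7) (pow_pos hx 7).ne'

/-- A nonvanishing analytic germ has an analytic eighth root. -/
lemma exists_analyticAt_pow_eight_eq {g : ℂ → ℂ} {z₀ : ℂ} (hg : AnalyticAt ℂ g z₀)
    (h0 : g z₀ ≠ 0) : ∃ q : ℂ → ℂ, AnalyticAt ℂ q z₀ ∧ ∀ᶠ z in 𝓝 z₀, q z ^ 8 = g z := by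
  obtain ⟨c, hc⟩ := IsAlgClosed.exists_pow_nat_eq (g z₀) (n := 8) (by norm_num)
  have hd : AnalyticAt ℂ (fun z ↦ g z / g z₀) z₀ := hg.div analyticAt_const h0
  have hs : g z₀ / g z₀ ∈ Complex.slitPlane := by simp [div_self h0]
  refine ⟨fun z ↦ c * Complex.exp (Complex.log (g z / g z₀) / 8),
    analyticAt_const.mul ((hd.clog hs).div analyticAt_const (by norm_num)).cexp, ?_⟩
  filter_upwards [hg.continuousAt.eventually_ne h0] with z hz
  rw [mul_pow, hc, ← Complex.exp_nat_mul]
  push_cast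
  rw [mul_div_cancel₀ _ (by norm_num : (8 : ℂ) ≠ 0), Complex.exp_log (div_ne_zero hz h0)]
  field_simp

lemma one_add_normSq_mul (p q : ℂ) :
    (1 + ‖p‖ ^ 2) * (1 + ‖q‖ ^ 2)
      = ‖1 + (starRingEnd ℂ) p * q‖ ^ 2 + ‖q - p‖ ^ 2 := by
  simp only [← Complex.normSq_eq_norm_sq, Complex.normSq_apply, Complex.add_re, Complex.add_im,
    Complex.mul_re, Complex.mul_im, Complex.conj_re, Complex.conj_im, Complex.sub_re,
    Complex.sub_im, Complex.one_re, Complex.one_im]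
  ring

/-- Near a nonzero value, `singularWeight ∘ g` is the modulus of an analytic function times
`1 + |ψ|²` with `ψ` analytic and vanishing at the base point. -/
lemma exists_singularWeight_factorization {g : ℂ → ℂ} {z₀ : ℂ} (hg : AnalyticAt ℂ g z₀)
    (h0 : g z₀ ≠ 0) : ∃ H ψ : ℂ → ℂ, AnalyticAt ℂ H z₀ ∧ AnalyticAt ℂ ψ z₀ ∧ ψ z₀ = 0 ∧
      (∀ᶠ z in 𝓝 z₀, singularWeight (g z) = ‖H z‖ * (1 + ‖ψ z‖ ^ 2)) ∧
      ‖deriv ψ z₀‖ ^ 2 = ‖deriv g z₀‖ ^ 2 /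
        (64 * (‖g z₀‖ ^ (1 / 4 : ℝ)) ^ 7 * (1 + ‖g z₀‖ ^ (1 / 4 : ℝ)) ^ 2) := by
  obtain ⟨q, hq, hqg⟩ := exists_analyticAt_pow_eight_eq hg h0
  have hX : ∀ z, q z ^ 8 = g z → ‖g z‖ ^ (1 / 4 : ℝ) = ‖q z‖ ^ 2 := by
    intro z hz
    rw [← hz, norm_pow, ← Real.rpow_natCast, ← Real.rpow_mul (norm_nonneg _),
      ← Real.rpow_natCast]
    norm_num
  have hq0 : q z₀ ≠ 0 := by
    intro h
    have := hqg.self_of_nhds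
    rw [h] at this
    exact h0 (by rw [← this]; norm_num)
  set p : ℂ := q z₀ with hp
  have hden : AnalyticAt ℂ (fun z ↦ 1 + (starRingEnd ℂ) p * q z) z₀ :=
    analyticAt_const.add (analyticAt_const.mul hq)
  have hden_val : (1 + (starRingEnd ℂ) p * q z₀) = ((1 + ‖p‖ ^ 2 : ℝ) : ℂ) := by
    rw [← hp, ← Complex.normSq_eq_conj_mul_self, Complex.normSq_eq_norm_sq]
    push_cast; rfl
  have hpos : (0 : ℝ) < 1 + ‖p‖ ^ 2 := by positivity
  have hden0 : (1 + (starRingEnd ℂ) p * q z₀) ≠ 0 := by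
    rw [hden_val]; exact_mod_cast hpos.ne'
  refine ⟨fun z ↦ (1 + (starRingEnd ℂ) p * q z) ^ 2 / ((1 + ‖p‖ ^ 2 : ℝ) : ℂ) / q z ^ 14,
    fun z ↦ (q z - p) / (1 + (starRingEnd ℂ) p * q z), ?_, ?_, ?_, ?_, ?_⟩
  · exact ((hden.pow 2).div analyticAt_const (by exact_mod_cast hpos.ne')).div (hq.pow 14)
      (pow_ne_zero _ hq0)
  · exact (hq.sub analyticAt_const).div hden hden0
  · simp [hp]
  · filter_upwards [hqg, hden.continuousAt.eventually_ne hden0,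
      hq.continuousAt.eventually_ne hq0] with z hz hzd hzq
    have hn := norm_pos_iff.2 hzd
    have hnq := norm_pos_iff.2 hzq
    have key := one_add_normSq_mul p (q z)
    rw [singularWeight, hX z hz]
    simp only [norm_div, norm_pow, Complex.norm_real, Real.norm_eq_abs, abs_of_pos hpos]
    rw [show (‖q z‖ ^ 2) ^ 7 = ‖q z‖ ^ 14 by ring]
    field_simp
    linarith
  · have hdq : 8 * p ^ 7 * deriv q z₀ = deriv g z₀ := by
      have h1 : HasDerivAt (fun z ↦ q z ^ 8) (8 * p ^ 7 * deriv q z₀) z₀ := by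
        simpa using hq.differentiableAt.hasDerivAt.fun_pow 8
      rw [← h1.deriv]
      exact Filter.EventuallyEq.deriv_eq hqg
    have hψ : deriv (fun z ↦ (q z - p) / (1 + (starRingEnd ℂ) p * q z)) z₀
        = deriv q z₀ / ((1 + ‖p‖ ^ 2 : ℝ) : ℂ) := by
      have h1 : HasDerivAt (fun z ↦ q z - p) (deriv q z₀) z₀ :=
        hq.differentiableAt.hasDerivAt.sub_const p
      have h2 := (h1.div hden.differentiableAt.hasDerivAt hden0).deriv
      refine h2.trans ?_
      rw [← hden_val, ← hp, sub_self, zero_mul, sub_zero]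
      have := hden0
      rw [← hp] at this
      field_simp
    have hpn := norm_pos_iff.2 hq0
    rw [hψ, ← hdq, hX z₀ hqg.self_of_nhds, ← hp]
    simp only [norm_div, norm_mul, norm_pow, Complex.norm_real, Real.norm_eq_abs, abs_of_pos hpos,
      Complex.norm_ofNat]
    field_simp
    norm_num

/-- Invariant form of `R² - |z|²` around a point of the disc. -/
lemma sq_sub_normSq_factorization {R : ℝ} {z₀ : ℂ} (hz₀ : 0 < R ^ 2 - ‖z₀‖ ^ 2) :
    ∃ K χ : ℂ → ℂ, AnalyticAt ℂ K z₀ ∧ AnalyticAt ℂ χ z₀ ∧ χ z₀ = 0 ∧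
      (∀ᶠ z in 𝓝 z₀, R ^ 2 - ‖z‖ ^ 2 = ‖K z‖ * (1 - R ^ 2 * ‖χ z‖ ^ 2)) ∧
      ‖deriv χ z₀‖ = 1 / (R ^ 2 - ‖z₀‖ ^ 2) := by
  set D := R ^ 2 - ‖z₀‖ ^ 2 with hD
  have hden : AnalyticAt ℂ (fun z ↦ ((R ^ 2 : ℝ) : ℂ) - (starRingEnd ℂ) z₀ * z) z₀ :=
    analyticAt_const.sub (analyticAt_const.mul analyticAt_id)
  have hval : ((R ^ 2 : ℝ) : ℂ) - (starRingEnd ℂ) z₀ * z₀ = (D : ℂ) := by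
    rw [← Complex.normSq_eq_conj_mul_self, Complex.normSq_eq_norm_sq, hD]
    push_cast; rfl
  have hden0 : ((R ^ 2 : ℝ) : ℂ) - (starRingEnd ℂ) z₀ * z₀ ≠ 0 := by
    rw [hval]; exact_mod_cast hz₀.ne'
  refine ⟨fun z ↦ (((R ^ 2 : ℝ) : ℂ) - (starRingEnd ℂ) z₀ * z) ^ 2 / (D : ℂ),
    fun z ↦ (z - z₀) / (((R ^ 2 : ℝ) : ℂ) - (starRingEnd ℂ) z₀ * z), ?_, ?_, ?_, ?_, ?_⟩
  · exact (hden.pow 2).div analyticAt_const (by exact_mod_cast hz₀.ne')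
  · exact (analyticAt_id.sub analyticAt_const).div hden hden0
  · simp
  · filter_upwards [hden.continuousAt.eventually_ne hden0] with z hz
    have hn := norm_pos_iff.2 hz
    have key : D * (R ^ 2 - ‖z‖ ^ 2)
        = ‖((R ^ 2 : ℝ) : ℂ) - (starRingEnd ℂ) z₀ * z‖ ^ 2 - R ^ 2 * ‖z - z₀‖ ^ 2 := by
      rw [hD]
      simp only [← Complex.normSq_eq_norm_sq, Complex.normSq_apply, Complex.mul_re,
        Complex.mul_im, Complex.conj_re, Complex.conj_im, Complex.sub_re,
        Complex.sub_im, Complex.ofReal_re, Complex.ofReal_im]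
      ring
    simp only [norm_div, norm_pow, Complex.norm_real, Real.norm_eq_abs, abs_of_pos hz₀]
    field_simp
    linarith
  · have h1 : HasDerivAt (fun z : ℂ ↦ z - z₀) 1 z₀ := (hasDerivAt_id z₀).sub_const z₀
    have h2 := (h1.div hden.differentiableAt.hasDerivAt hden0).deriv
    have h3 : deriv (fun z ↦ (z - z₀) / (((R ^ 2 : ℝ) : ℂ) - (starRingEnd ℂ) z₀ * z)) z₀
        = 1 / (D : ℂ) := by
      refine h2.trans ?_
      rw [hval, sub_self, zero_mul, sub_zero]
      have : (D : ℂ) ≠ 0 := by exact_mod_cast hz₀.ne'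
      field_simp
    rw [h3]
    simp [abs_of_pos hz₀]

/-- A second-order condition at a local maximum, deduced from the maximum modulus principle. -/
lemma normSq_deriv_le_of_eventually_le {H ψ χ : ℂ → ℂ} {z₀ : ℂ} {c : ℝ} (hc : 0 ≤ c)
    (hH : AnalyticAt ℂ H z₀) (hH0 : H z₀ ≠ 0)
    (hψ : AnalyticAt ℂ ψ z₀) (hψ0 : ψ z₀ = 0) (hχ : AnalyticAt ℂ χ z₀) (hχ0 : χ z₀ = 0)
    (hmax : ∀ᶠ z in 𝓝 z₀, ‖H z‖ * (1 + ‖ψ z‖ ^ 2) * (1 - c * ‖χ z‖ ^ 2) ^ 4 ≤ ‖H z₀‖) :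
    ‖deriv ψ z₀‖ ^ 2 ≤ 4 * c * ‖deriv χ z₀‖ ^ 2 := by
  by_contra! hlt
  have hdψ : ContinuousAt (dslope ψ z₀) z₀ := continuousAt_dslope_same.2 hψ.differentiableAt
  have hdχ : ContinuousAt (dslope χ z₀) z₀ := continuousAt_dslope_same.2 hχ.differentiableAt
  have hcχ := hχ.continuousAt
  have hv1 : ∀ᶠ z in 𝓝 z₀, c * ‖χ z‖ ^ 2 < 1 := by
    have : ContinuousAt (fun z ↦ c * ‖χ z‖ ^ 2) z₀ := by fun_prop
    exact this.eventually_lt continuousAt_const (by simp [hχ0])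
  have hcmp : ∀ᶠ z in 𝓝 z₀,
      4 * c * ‖dslope χ z₀ z‖ ^ 2 < ‖dslope ψ z₀ z‖ ^ 2 * (1 - 4 * (c * ‖χ z‖ ^ 2)) := by
    have h1 : ContinuousAt (fun z ↦ 4 * c * ‖dslope χ z₀ z‖ ^ 2) z₀ := by fun_prop
    have h2 : ContinuousAt
      (fun z ↦ ‖dslope ψ z₀ z‖ ^ 2 * (1 - 4 * (c * ‖χ z‖ ^ 2))) z₀ := by fun_prop
    exact h1.eventually_lt h2 (by simpa [hχ0] using hlt)
  have hstrict : ∀ᶠ z in 𝓝 z₀, z ≠ z₀ → ‖H z‖ < ‖H z₀‖ := by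
    filter_upwards [hmax, hv1, hcmp] with z hm hv hcz hz
    by_contra! hle
    have hHp : 0 < ‖H z₀‖ := norm_pos_iff.2 hH0
    have hzp : 0 < ‖z - z₀‖ ^ 2 := by
      have := norm_pos_iff.2 (sub_ne_zero.2 hz)
      positivity
    have e1 : ‖ψ z‖ ^ 2 = ‖z - z₀‖ ^ 2 * ‖dslope ψ z₀ z‖ ^ 2 := by
      have := sub_smul_dslope ψ z₀ z
      rw [hψ0, sub_zero, smul_eq_mul] at this
      rw [← this, norm_mul, mul_pow]
    have e2 : ‖χ z‖ ^ 2 = ‖z - z₀‖ ^ 2 * ‖dslope χ z₀ z‖ ^ 2 := by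
      have := sub_smul_dslope χ z₀ z
      rw [hχ0, sub_zero, smul_eq_mul] at this
      rw [← this, norm_mul, mul_pow]
    have huv : 4 * (c * ‖χ z‖ ^ 2) < ‖ψ z‖ ^ 2 * (1 - 4 * (c * ‖χ z‖ ^ 2)) := by
      have := mul_lt_mul_of_pos_left hcz hzp
      rw [e1]
      calc 4 * (c * ‖χ z‖ ^ 2) = ‖z - z₀‖ ^ 2 * (4 * c * ‖dslope χ z₀ z‖ ^ 2) := by
            rw [e2]; ring
        _ < _ := this
        _ = _ := by ring
    set u := ‖ψ z‖ ^ 2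
    set v := c * ‖χ z‖ ^ 2
    have hu0 : 0 ≤ u := by positivity
    have hv0 : 0 ≤ v := by positivity
    have hb : 1 - 4 * v ≤ (1 - v) ^ 4 := by
      have := one_add_mul_le_pow (a := -v) (by linarith) 4
      push_cast at this
      calc 1 - 4 * v = 1 + 4 * -v := by ring
        _ ≤ (1 + -v) ^ 4 := this
        _ = _ := by ring
    have hgt : 1 < (1 + u) * (1 - v) ^ 4 := by
      have := mul_le_mul_of_nonneg_left hb (by linarith : 0 ≤ 1 + u)
      nlinarith
    have : ‖H z₀‖ < ‖H z‖ * ((1 + u) * (1 - v) ^ 4) := by nlinarith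
    rw [← mul_assoc] at this
    linarith
  have hloc : IsLocalMax (norm ∘ H) z₀ := by
    filter_upwards [hstrict] with z hz
    rcases eq_or_ne z z₀ with rfl | h
    · exact le_rfl
    · exact (hz h).le
  have hconst := Complex.eventually_eq_of_isLocalMax_norm
    (hH.eventually_analyticAt.mono fun z hz ↦ hz.differentiableAt) hloc
  have hne : ∀ᶠ z in 𝓝[≠] z₀, False := by
    filter_upwards [hconst.filter_mono nhdsWithin_le_nhds, hstrict.filter_mono nhdsWithin_le_nhds,
      self_mem_nhdsWithin] with z h1 h2 h3
    have := h2 h3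
    rw [h1] at this
    exact lt_irrefl _ this
  exact hne.exists.elim fun _ h ↦ h

/-- Among three distinct points, the one nearest to `w` controls the product of the
weights. -/
lemma exists_prod_singularWeight_le (a : Fin 3 → ℂ) (ha : Function.Injective a) :
    ∃ C : ℝ, 0 < C ∧ ∀ w : ℂ, (∀ k, w ≠ a k) → ∃ k, ∃ κ : ℝ, 0 < κ ∧
      κ = ((‖w - a k‖ ^ (1 / 4 : ℝ)) ^ 7 * (1 + ‖w - a k‖ ^ (1 / 4 : ℝ)) ^ 2)⁻¹ ∧
      ∏ j, singularWeight (w - a j) ≤ C * κ ^ 2 ∧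
      ‖w‖ ^ 2 * ∏ j, singularWeight (w - a j) ≤ C * κ := by
  obtain ⟨d, hd, hsep⟩ : ∃ d : ℝ, 0 < d ∧ ∀ i j, i ≠ j → 2 * d ≤ ‖a i - a j‖ := by
    have h01 : 0 < ‖a 0 - a 1‖ := norm_pos_iff.2 (sub_ne_zero.2 (ha.ne (by decide)))
    have h02 : 0 < ‖a 0 - a 2‖ := norm_pos_iff.2 (sub_ne_zero.2 (ha.ne (by decide)))
    have h12 : 0 < ‖a 1 - a 2‖ := norm_pos_iff.2 (sub_ne_zero.2 (ha.ne (by decide)))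
    have hm1 := min_le_left ‖a 0 - a 1‖ (min ‖a 0 - a 2‖ ‖a 1 - a 2‖)
    have hm2 := (min_le_right ‖a 0 - a 1‖ (min ‖a 0 - a 2‖ ‖a 1 - a 2‖)).trans (min_le_left _ _)
    have hm3 := (min_le_right ‖a 0 - a 1‖ (min ‖a 0 - a 2‖ ‖a 1 - a 2‖)).trans (min_le_right _ _)
    refine ⟨min ‖a 0 - a 1‖ (min ‖a 0 - a 2‖ ‖a 1 - a 2‖) / 2, by positivity, ?_⟩
    intro i j hij
    rw [mul_div_cancel₀ _ two_ne_zero]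
    fin_cases i <;> fin_cases j <;>
      first
        | exact absurd rfl hij
        | assumption
        | (refine le_of_le_of_eq ?_ (norm_sub_rev _ _); assumption)
  set e : ℝ := d ^ (1 / 4 : ℝ) with he
  have hepos : 0 < e := Real.rpow_pos_of_pos hd _
  set M : ℝ := ((1 + e) / e) ^ 7 with hM
  have hMpos : 0 < M := by positivity
  set A : ℝ := ∑ j, ‖a j‖ with hA
  have hA0 : 0 ≤ A := Finset.sum_nonneg fun j _ ↦ norm_nonneg _
  refine ⟨M ^ 2 * (A + 1) ^ 2, by positivity, fun w hw ↦ ?_⟩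
  obtain ⟨k, -, hk⟩ := Finset.exists_min_image Finset.univ (fun j ↦ ‖w - a j‖) ⟨0, by simp⟩
  set x : ℝ := ‖w - a k‖ ^ (1 / 4 : ℝ) with hx
  have hxpos : 0 < x := Real.rpow_pos_of_pos (norm_pos_iff.2 (sub_ne_zero.2 (hw k))) _
  have hfar : ∀ j ∈ Finset.univ.erase k, singularWeight (w - a j) ≤ M * ((1 + x) ^ 6)⁻¹ := by
    intro j hj
    have hjk : j ≠ k := Finset.ne_of_mem_erase hj
    have hle := hk j (Finset.mem_univ j)
    have hdj : d ≤ ‖w - a j‖ := by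
      have h1 := hsep j k hjk
      have h2 : ‖a j - a k‖ ≤ ‖w - a k‖ + ‖w - a j‖ := by
        calc ‖a j - a k‖ = ‖(w - a k) - (w - a j)‖ := by congr 1; ring
          _ ≤ _ := norm_sub_le _ _
      linarith
    rw [singularWeight]
    set y : ℝ := ‖w - a j‖ ^ (1 / 4 : ℝ) with hy
    have hxy : x ≤ y := Real.rpow_le_rpow (norm_nonneg _) hle (by norm_num)
    have hey : e ≤ y := Real.rpow_le_rpow hd.le hdj (by norm_num)
    have hypos : 0 < y := hepos.trans_le hey
    have h1 : 1 + y ≤ (1 + e) / e * y := by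
      rw [div_mul_eq_mul_div, le_div_iff₀ hepos]; nlinarith
    have h2 : (1 + y) ^ 7 ≤ M * y ^ 7 := by
      rw [hM, ← mul_pow]; gcongr
    have h3 : (1 + x) ^ 6 ≤ (1 + y) ^ 6 := by gcongr
    rw [div_le_iff₀ (by positivity), ← div_eq_mul_inv, div_mul_eq_mul_div,
      le_div_iff₀ (by positivity)]
    calc (1 + y) * (1 + x) ^ 6 ≤ (1 + y) * (1 + y) ^ 6 := by gcongr
      _ = (1 + y) ^ 7 := by ring
      _ ≤ _ := h2
  have hprod : ∏ j, singularWeight (w - a j) ≤ M ^ 2 * ((1 + x) ^ 11 * x ^ 7)⁻¹ := by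
    rw [← Finset.mul_prod_erase Finset.univ _ (Finset.mem_univ k)]
    have h1 : ∏ j ∈ Finset.univ.erase k, singularWeight (w - a j)
        ≤ (M * ((1 + x) ^ 6)⁻¹) ^ 2 := by
      refine (Finset.prod_le_prod (fun j _ ↦ singularWeight_nonneg _) hfar).trans ?_
      simp
    calc _ ≤ singularWeight (w - a k) * (M * ((1 + x) ^ 6)⁻¹) ^ 2 :=
          mul_le_mul_of_nonneg_left h1 (singularWeight_nonneg _)
      _ = _ := by
          rw [singularWeight, ← hx]
          field_simp
  have hw' : ‖w‖ ≤ (A + 1) * (1 + x) ^ 4 := by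
    have h1 : ‖w‖ ≤ ‖w - a k‖ + ‖a k‖ := by simpa using norm_add_le (w - a k) (a k)
    have h2 : ‖a k‖ ≤ A :=
      Finset.single_le_sum (f := fun j ↦ ‖a j‖) (fun j _ ↦ norm_nonneg _) (Finset.mem_univ k)
    have h3 : x ^ 4 = ‖w - a k‖ := norm_rpow_quarter_pow _
    have h4 : x ^ 4 ≤ (1 + x) ^ 4 := by gcongr; linarith
    have h5 : 1 ≤ (1 + x) ^ 4 := one_le_pow₀ (by linarith)
    nlinarith
  refine ⟨k, (x ^ 7 * (1 + x) ^ 2)⁻¹, by positivity, rfl, hprod.trans ?_, ?_⟩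
  · have h1 : ((1 + x) ^ 11 * x ^ 7)⁻¹ ≤ ((x ^ 7 * (1 + x) ^ 2)⁻¹) ^ 2 := by
      rw [inv_pow]
      apply inv_anti₀ (by positivity)
      have : x ^ 7 ≤ (1 + x) ^ 7 := by gcongr; linarith
      calc (x ^ 7 * (1 + x) ^ 2) ^ 2 = x ^ 7 * (x ^ 7 * (1 + x) ^ 4) := by ring
        _ ≤ (1 + x) ^ 7 * (x ^ 7 * (1 + x) ^ 4) := by gcongr
        _ = _ := by ring
    have h2 : M ^ 2 ≤ M ^ 2 * (A + 1) ^ 2 :=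
      le_mul_of_one_le_right (by positivity) (one_le_pow₀ (by linarith))
    gcongr
  · calc ‖w‖ ^ 2 * ∏ j, singularWeight (w - a j)
        ≤ ((A + 1) * (1 + x) ^ 4) ^ 2 * (M ^ 2 * ((1 + x) ^ 11 * x ^ 7)⁻¹) := by
          gcongr
          exact Finset.prod_nonneg fun j _ ↦ singularWeight_nonneg _
      _ = M ^ 2 * (A + 1) ^ 2 * ((x ^ 7 * (1 + x) ^ 2)⁻¹ * (1 + x)⁻¹) := by
          field_simp
      _ ≤ _ := by
          gcongr
          exact mul_le_of_le_one_right (by positivity) (inv_le_one_of_one_le₀ (by linarith))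

/-- At a point where `f = f' = a`, the product `f' (f' - f)` vanishes to at least the order
of `f - a`. -/
lemma exists_norm_deriv_mul_le {f : ℂ → ℂ} {z₀ a : ℂ} (hf : AnalyticAt ℂ f z₀)
    (hfa : f z₀ = a) (hda : deriv f z₀ = a) (hord : analyticOrderAt (fun z ↦ f z - a) z₀ ≠ ⊤) :
    ∃ C : ℝ, ∀ᶠ z in 𝓝 z₀, ‖deriv f z * (deriv f z - f z)‖ ≤ C * ‖f z - a‖ := by
  have hg : AnalyticAt ℂ (fun z ↦ f z - a) z₀ := hf.sub analyticAt_const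
  obtain ⟨h, hh, hh0, hgh⟩ := hg.analyticOrderAt_ne_top.1 hord
  obtain ⟨m, hm⟩ : ∃ m, analyticOrderNatAt (fun z ↦ f z - a) z₀ = m + 1 := by
    refine Nat.exists_eq_succ_of_ne_zero fun h0 ↦ hh0 ?_
    have := hgh.self_of_nhds
    rw [h0] at this
    simpa [hfa] using this.symm
  rw [hm] at hgh
  simp only [smul_eq_mul] at hgh
  set l : ℂ → ℂ := fun z ↦ (m + 1) * h z + (z - z₀) * deriv h z with hl
  have hdl : ∀ᶠ z in 𝓝 z₀, deriv f z = (z - z₀) ^ m * l z := by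
    filter_upwards [hgh.eventually_nhds, hh.eventually_analyticAt] with z hz hhz
    have h1 : HasDerivAt (fun z ↦ (z - z₀) ^ (m + 1) * h z)
        (((m + 1 : ℕ) : ℂ) * (z - z₀) ^ m * 1 * h z + (z - z₀) ^ (m + 1) * deriv h z) z :=
      (((hasDerivAt_id z).sub_const z₀).fun_pow (m + 1)).mul hhz.differentiableAt.hasDerivAt
    have h2 : deriv (fun z ↦ f z - a) z = deriv f z := deriv_sub_const ..
    rw [← h2, Filter.EventuallyEq.deriv_eq hz, h1.deriv, hl]
    push_cast
    ring
  have hlc : ContinuousAt l z₀ := by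
    have := hh.continuousAt
    have := hh.deriv.continuousAt
    fun_prop
  obtain ⟨k, hk, hfk⟩ : ∃ k : ℂ → ℂ, ContinuousAt k z₀ ∧
      ∀ᶠ z in 𝓝 z₀, deriv f z * (deriv f z - f z) = (z - z₀) ^ (m + 1) * k z := by
    rcases m with _ | m
    · have hq : AnalyticAt ℂ (fun z ↦ deriv f z - f z) z₀ := hf.deriv.sub hf
      refine ⟨fun z ↦ deriv f z * dslope (fun z ↦ deriv f z - f z) z₀ z,
        hf.deriv.continuousAt.mul (continuousAt_dslope_same.2 hq.differentiableAt),
        Eventually.of_forall fun z ↦ ?_⟩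
      have := sub_smul_dslope (fun z ↦ deriv f z - f z) z₀ z
      simp only [hfa, hda, sub_self, sub_zero, smul_eq_mul] at this
      rw [← this]
      ring
    · have ha : a = 0 := by
        rw [← hda, hdl.self_of_nhds]
        simp
      refine ⟨fun z ↦ (z - z₀) ^ m * l z * (l z - (z - z₀) * h z), ?_, ?_⟩
      · have := hh.continuousAt
        fun_prop
      · filter_upwards [hgh, hdl] with z h1 h2
        rw [ha, sub_zero] at h1
        rw [h1, h2]
        ring
  have hhc := hh.continuousAt
  refine ⟨(‖k z₀‖ + 1) / (‖h z₀‖ / 2), ?_⟩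
  have hhp := norm_pos_iff.2 hh0
  filter_upwards [hgh, hfk,
    hk.norm.eventually_lt continuousAt_const (lt_add_one ‖k z₀‖),
    (continuousAt_const (y := ‖h z₀‖ / 2)).eventually_lt hhc.norm (by linarith)]
    with z h1 h2 h3 h4
  rw [h1, h2, norm_mul, norm_mul]
  have : ‖k z‖ ≤ (‖k z₀‖ + 1) / (‖h z₀‖ / 2) * ‖h z‖ := by
    rw [div_mul_eq_mul_div, le_div_iff₀ (by positivity)]
    exact mul_le_mul h3.le h4.le (by positivity) (by positivity)
  calc _ ≤ ‖(z - z₀) ^ (m + 1)‖ * ((‖k z₀‖ + 1) / (‖h z₀‖ / 2) * ‖h z‖) := by gcongr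
    _ = _ := by ring

lemma continuousAt_normSq_mul_singularWeight {f : ℂ → ℂ} {z₀ a : ℂ} (hf : AnalyticAt ℂ f z₀)
    (hfa : f z₀ = a) (hda : deriv f z₀ = a) (hord : analyticOrderAt (fun z ↦ f z - a) z₀ ≠ ⊤) :
    ContinuousAt (fun z ↦ ‖deriv f z * (deriv f z - f z)‖ ^ 2 * singularWeight (f z - a)) z₀ := by
  obtain ⟨C, hC⟩ := exists_norm_deriv_mul_le hf hfa hda hord
  have hx : ContinuousAt (fun z ↦ ‖f z - a‖ ^ (1 / 4 : ℝ)) z₀ :=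
    (hf.continuousAt.sub continuousAt_const).norm.rpow_const (Or.inr (by norm_num))
  have hlim : Tendsto (fun z ↦ C ^ 2 * (‖f z - a‖ ^ (1 / 4 : ℝ) * (1 + ‖f z - a‖ ^ (1 / 4 : ℝ))))
      (𝓝 z₀) (𝓝 0) := by
    have : ContinuousAt
      (fun z ↦ C ^ 2 * (‖f z - a‖ ^ (1 / 4 : ℝ) * (1 + ‖f z - a‖ ^ (1 / 4 : ℝ)))) z₀ := by fun_prop
    have h0 := this.tendsto
    simpa [hfa] using h0
  rw [ContinuousAt, show ‖deriv f z₀ * (deriv f z₀ - f z₀)‖ ^ 2 * singularWeight (f z₀ - a) = 0 by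
    simp [hfa, hda]]
  refine squeeze_zero' (Eventually.of_forall fun z ↦
    mul_nonneg (by positivity) (singularWeight_nonneg _)) ?_ hlim
  filter_upwards [hC] with z hz
  have hsq : ‖deriv f z * (deriv f z - f z)‖ ^ 2 ≤ C ^ 2 * ‖f z - a‖ ^ 2 := by
    rw [← mul_pow]; gcongr
  refine (mul_le_mul_of_nonneg_right hsq (singularWeight_nonneg _)).trans (le_of_eq ?_)
  have h4 := norm_rpow_quarter_pow (f z - a)
  rw [singularWeight]
  set x := ‖f z - a‖ ^ (1 / 4 : ℝ)
  rw [← h4]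
  rcases eq_or_ne x 0 with h | h
  · simp [h]
  · field_simp

/-- The conformal density whose vanishing forces `f' = f`. -/
noncomputable def sharingDensity (f : ℂ → ℂ) (a : Fin 3 → ℂ) (z : ℂ) : ℝ :=
  ‖deriv f z * (deriv f z - f z)‖ ^ 2 * ∏ k, singularWeight (f z - a k)

lemma continuous_sharingDensity {f : ℂ → ℂ} (hf : Differentiable ℂ f)
    (hnonconst : ¬ ∃ c : ℂ, ∀ z : ℂ, f z = c)
    {a : Fin 3 → ℂ} (ha : Function.Injective a)
    (hshare : ∀ (k : Fin 3) (z : ℂ), f z = a k → deriv f z = a k) :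
    Continuous (sharingDensity f a) := by
  rw [continuous_iff_continuousAt]
  intro z₀
  have hfa := hf.analyticAt z₀
  have hweight : ∀ j, f z₀ ≠ a j → ContinuousAt (fun z ↦ singularWeight (f z - a j)) z₀ :=
    fun j hj ↦ ContinuousAt.comp (f := fun z ↦ f z - a j)
      (continuousAt_singularWeight (sub_ne_zero.2 hj))
      (hfa.continuousAt.sub continuousAt_const)
  by_cases h : ∃ k, f z₀ = a k
  · obtain ⟨k, hk⟩ := h
    have hord : analyticOrderAt (fun z ↦ f z - a k) z₀ ≠ ⊤ := by
      intro htop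
      rw [analyticOrderAt_eq_top] at htop
      refine hnonconst ⟨a k, fun z ↦ sub_eq_zero.1 ?_⟩
      have han : AnalyticOnNhd ℂ (fun z ↦ f z - a k) Set.univ :=
        fun z _ ↦ (hf.analyticAt z).sub analyticAt_const
      exact congrFun (han.eq_of_eventuallyEq (g := fun _ ↦ 0) (fun _ _ ↦ analyticAt_const) htop) z
    have hmain := continuousAt_normSq_mul_singularWeight hfa hk (hshare k z₀ hk) hord
    have hrest : ContinuousAt
        (fun z ↦ ∏ j ∈ Finset.univ.erase k, singularWeight (f z - a j)) z₀ :=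
      tendsto_finsetProd _ fun j hj ↦ hweight j fun hj' ↦
        Finset.ne_of_mem_erase hj (ha (hj'.symm.trans hk))
    refine (hmain.mul hrest).congr (Eventually.of_forall fun z ↦ ?_)
    simp only [sharingDensity, Pi.mul_apply]
    rw [mul_assoc, Finset.mul_prod_erase Finset.univ (fun j ↦ singularWeight (f z - a j))
      (Finset.mem_univ k)]
  · push Not at h
    have h1 : ContinuousAt (fun z ↦ ‖deriv f z * (deriv f z - f z)‖ ^ 2) z₀ :=
      ((hfa.deriv.mul (hfa.deriv.sub hfa)).continuousAt.norm).pow 2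
    exact h1.mul (tendsto_finsetProd _ fun j _ ↦ hweight j (h j))

/-- At a maximum of the density weighted by the disc, the derivative of `f` is controlled. -/
lemma normSq_deriv_le_of_isLocalMax {f : ℂ → ℂ} (hf : Differentiable ℂ f) {a : Fin 3 → ℂ}
    {R : ℝ} {z₁ : ℂ} (hD : 0 < R ^ 2 - ‖z₁‖ ^ 2) (hne : ∀ k, f z₁ ≠ a k)
    (hpos : 0 < sharingDensity f a z₁)
    (hmax : IsLocalMax (fun z ↦ sharingDensity f a z * (R ^ 2 - ‖z‖ ^ 2) ^ 4) z₁) (k : Fin 3) :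
    ‖deriv f z₁‖ ^ 2 * ((‖f z₁ - a k‖ ^ (1 / 4 : ℝ)) ^ 7 *
      (1 + ‖f z₁ - a k‖ ^ (1 / 4 : ℝ)) ^ 2)⁻¹ ≤ 256 * (R ^ 2 / (R ^ 2 - ‖z₁‖ ^ 2) ^ 2) := by
  have hfa := hf.analyticAt z₁
  choose H ψ hH hψ hψ0 hHψ hdψ using fun j ↦ exists_singularWeight_factorization
    (g := fun z ↦ f z - a j) (z₀ := z₁) (hfa.sub analyticAt_const) (sub_ne_zero.2 (hne j))
  obtain ⟨K, χ, hK, hχ, hχ0, hKχ, hdχ⟩ := sq_sub_normSq_factorization hD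
  set L : ℂ → ℂ := fun z ↦ (deriv f z * (deriv f z - f z)) ^ 2 * (∏ j, H j z) * K z ^ 4 with hL
  have hLan : AnalyticAt ℂ L z₁ :=
    (((hfa.deriv.mul (hfa.deriv.sub hfa)).pow 2).mul
      (Finset.univ.analyticAt_fun_prod fun j _ ↦ hH j)).mul (hK.pow 4)
  have hfac : ∀ᶠ z in 𝓝 z₁, sharingDensity f a z * (R ^ 2 - ‖z‖ ^ 2) ^ 4
      = ‖L z‖ * (∏ j, (1 + ‖ψ j z‖ ^ 2)) * (1 - R ^ 2 * ‖χ z‖ ^ 2) ^ 4 := by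
    filter_upwards [hKχ, eventually_all.2 hHψ] with z h1 h2
    rw [sharingDensity, h1, Finset.prod_congr rfl fun j _ ↦ h2 j, Finset.prod_mul_distrib, hL]
    simp only [norm_mul, norm_pow, norm_prod]
    ring
  have hfac₁ : sharingDensity f a z₁ * (R ^ 2 - ‖z₁‖ ^ 2) ^ 4 = ‖L z₁‖ := by
    rw [hfac.self_of_nhds]
    simp [hψ0, hχ0]
  have hL0 : L z₁ ≠ 0 := by
    rw [← norm_pos_iff, ← hfac₁]
    positivity
  have key := normSq_deriv_le_of_eventually_le (sq_nonneg R) hLan hL0 (hψ k) (hψ0 k) hχ hχ0 (by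
    filter_upwards [hfac, hmax] with z h1 h2
    rw [hfac₁, h1] at h2
    refine le_trans ?_ h2
    gcongr
    rw [← Finset.mul_prod_erase Finset.univ _ (Finset.mem_univ k)]
    refine le_mul_of_one_le_right (by positivity) ?_
    simpa using Finset.prod_le_prod (s := Finset.univ.erase k) (f := fun _ ↦ (1 : ℝ))
      (g := fun j ↦ 1 + ‖ψ j z‖ ^ 2) (fun _ _ ↦ zero_le_one)
      fun j _ ↦ le_add_of_nonneg_right (sq_nonneg _))
  have hd : deriv (fun z ↦ f z - a k) z₁ = deriv f z₁ := deriv_sub_const ..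
  rw [hdψ k, hdχ, hd] at key
  have e : ∀ u v w : ℝ, u / (64 * v * w) = u * (v * w)⁻¹ / 64 := by
    intro u v w; rw [mul_assoc, div_mul_eq_div_div_swap, div_eq_mul_inv u]
  rw [e, div_le_iff₀ (by norm_num)] at key
  refine key.trans (le_of_eq ?_)
  field_simp
  ring

lemma sharingDensity_eq_zero {f : ℂ → ℂ} (hf : Differentiable ℂ f)
    (hnonconst : ¬ ∃ c : ℂ, ∀ z : ℂ, f z = c)
    {a : Fin 3 → ℂ} (ha : Function.Injective a)
    (hshare : ∀ (k : Fin 3) (z : ℂ), f z = a k → deriv f z = a k) (z₀ : ℂ) :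
    sharingDensity f a z₀ = 0 := by
  by_contra hne
  have hW0 : ∀ z, 0 ≤ sharingDensity f a z := fun z ↦
    mul_nonneg (by positivity) (Finset.prod_nonneg fun j _ ↦ singularWeight_nonneg _)
  have hWpos : 0 < sharingDensity f a z₀ := (hW0 z₀).lt_of_ne' hne
  have hcont := continuous_sharingDensity hf hnonconst ha hshare
  obtain ⟨C, hC, hCw⟩ := exists_prod_singularWeight_le a ha
  have hbound : ∀ R : ℝ, 1 ≤ R → ‖z₀‖ < R →
      sharingDensity f a z₀ * (R ^ 2 - ‖z₀‖ ^ 2) ^ 4 ≤ 4 * C * (256 + 256 ^ 2) * R ^ 6 := by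
    intro R hR hz₀
    have hΦc : Continuous (fun z : ℂ ↦ sharingDensity f a z * (R ^ 2 - ‖z‖ ^ 2) ^ 4) := by
      fun_prop
    obtain ⟨z₁, hz₁, hmax⟩ := (isCompact_closedBall (0 : ℂ) R).exists_isMaxOn
      ⟨0, by simp; linarith⟩ hΦc.continuousOn
    have hle := hmax (show z₀ ∈ Metric.closedBall (0 : ℂ) R by simpa using hz₀.le)
    simp only [Set.mem_ofPred_eq] at hle
    refine hle.trans ?_
    have hD₀ : 0 < R ^ 2 - ‖z₀‖ ^ 2 := by nlinarith [norm_nonneg z₀]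
    have hΦpos : 0 < sharingDensity f a z₁ * (R ^ 2 - ‖z₁‖ ^ 2) ^ 4 :=
      lt_of_lt_of_le (by positivity) hle
    have hz₁R : ‖z₁‖ < R := by
      refine lt_of_le_of_ne (by simpa using hz₁) fun h ↦ ?_
      simp [h] at hΦpos
    have hD : 0 < R ^ 2 - ‖z₁‖ ^ 2 := by nlinarith [norm_nonneg z₁]
    have hW₁ : 0 < sharingDensity f a z₁ := (hW0 z₁).lt_of_ne' fun h ↦ by simp [h] at hΦpos
    have hloc := hmax.isLocalMax (Metric.closedBall_mem_nhds_of_mem (by simpa using hz₁R))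
    have hne₁ : ∀ k, f z₁ ≠ a k := by
      intro k hk
      rw [sharingDensity, hshare k z₁ hk, hk] at hW₁
      simp at hW₁
    obtain ⟨k, κ, hκ, hκe, hP1, hP2⟩ := hCw (f z₁) hne₁
    have hT := normSq_deriv_le_of_isLocalMax hf hD hne₁ hW₁ hloc k
    rw [← hκe] at hT
    set T := 256 * (R ^ 2 / (R ^ 2 - ‖z₁‖ ^ 2) ^ 2) with hTdef
    set P := ∏ j, singularWeight (f z₁ - a j) with hP
    have hP0 : 0 ≤ P := Finset.prod_nonneg fun j _ ↦ singularWeight_nonneg _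
    have hT0 : 0 ≤ T := by positivity
    have hWT : sharingDensity f a z₁ ≤ 4 * C * (T + T ^ 2) := by
      rw [sharingDensity, ← hP, norm_mul, mul_pow]
      have htri : ‖deriv f z₁ - f z₁‖ ≤ ‖deriv f z₁‖ + ‖f z₁‖ := norm_sub_le _ _
      rcases le_total ‖f z₁‖ ‖deriv f z₁‖ with hc | hc
      · calc ‖deriv f z₁‖ ^ 2 * ‖deriv f z₁ - f z₁‖ ^ 2 * P
            ≤ ‖deriv f z₁‖ ^ 2 * (2 * ‖deriv f z₁‖) ^ 2 * (C * κ ^ 2) := by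
              gcongr; linarith
          _ = 4 * C * (‖deriv f z₁‖ ^ 2 * κ) ^ 2 := by ring
          _ ≤ 4 * C * T ^ 2 := by gcongr
          _ ≤ _ := by gcongr; linarith
      · calc ‖deriv f z₁‖ ^ 2 * ‖deriv f z₁ - f z₁‖ ^ 2 * P
            ≤ ‖deriv f z₁‖ ^ 2 * (2 * ‖f z₁‖) ^ 2 * P := by
              gcongr; linarith
          _ = 4 * ‖deriv f z₁‖ ^ 2 * (‖f z₁‖ ^ 2 * P) := by ring
          _ ≤ 4 * ‖deriv f z₁‖ ^ 2 * (C * κ) := by gcongr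
          _ = 4 * C * (‖deriv f z₁‖ ^ 2 * κ) := by ring
          _ ≤ 4 * C * T := by gcongr
          _ ≤ _ := by gcongr; nlinarith
    calc sharingDensity f a z₁ * (R ^ 2 - ‖z₁‖ ^ 2) ^ 4
        ≤ 4 * C * (T + T ^ 2) * (R ^ 2 - ‖z₁‖ ^ 2) ^ 4 := by gcongr
      _ = 4 * C * (256 * (R ^ 2 * (R ^ 2 - ‖z₁‖ ^ 2) ^ 2) + 256 ^ 2 * R ^ 4) := by
          rw [hTdef]; field_simp
      _ ≤ 4 * C * (256 * (R ^ 2 * (R ^ 2) ^ 2) + 256 ^ 2 * R ^ 6) := by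
          gcongr
          · linarith [sq_nonneg ‖z₁‖]
          · norm_num
      _ = _ := by ring
  set B := 4 * C * (256 + 256 ^ 2) with hB
  set w := sharingDensity f a z₀
  have hBpos : 0 < B := by positivity
  set R := 1 + 2 * ‖z₀‖ + 16 * B / w with hR
  have hq : 0 < 16 * B / w := by positivity
  have hn := norm_nonneg z₀
  have hR1 : 1 < R := by linarith
  have hlt := hbound R hR1.le (by linarith)
  have hhalf : R ^ 2 / 2 ≤ R ^ 2 - ‖z₀‖ ^ 2 := by nlinarith
  have h4 : w * (R ^ 2 / 2) ^ 4 ≤ B * R ^ 6 := le_trans (by gcongr) hlt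
  have h5 : w * R ^ 2 ≤ 16 * B := by
    have : (w * R ^ 2) * R ^ 6 ≤ (16 * B) * R ^ 6 := by nlinarith
    exact le_of_mul_le_mul_right this (by positivity)
  have h6 : 16 * B < w * R := by
    have : w * (16 * B / w) = 16 * B := by field_simp
    nlinarith
  nlinarith

/-- **Three Values Entire.** If a nonconstant entire function `f` partially shares
three pairwise distinct finite values with its derivative, then `f' = f`. -/
theorem three_values_entire
    (f : ℂ → ℂ) (hf : Differentiable ℂ f)
    (hnonconst : ¬ ∃ c : ℂ, ∀ z : ℂ, f z = c)
    (a : Fin 3 → ℂ) (hinj : Function.Injective a)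
    (hshare : ∀ (k : Fin 3) (z : ℂ), f z = a k → deriv f z = a k) :
    deriv f = f := by
  have hd : Differentiable ℂ (deriv f) := fun z ↦ (hf.analyticAt z).deriv.differentiableAt
  have hzero : ∀ z, deriv f z * (deriv f z - f z) = 0 := by
    intro z
    have h := sharingDensity_eq_zero hf hnonconst hinj hshare z
    by_cases hk : ∃ k, f z = a k
    · obtain ⟨k, hk⟩ := hk
      rw [hshare k z hk, hk, sub_self, mul_zero]
    · push Not at hk
      have hprod : ∏ k, singularWeight (f z - a k) ≠ 0 :=
        Finset.prod_ne_zero_iff.2 fun k _ ↦ (singularWeight_pos (sub_ne_zero.2 (hk k))).ne'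
      simpa [sharingDensity, hprod] using h
  by_contra hne
  obtain ⟨z₀, hz₀⟩ : ∃ z, deriv f z ≠ f z := by
    by_contra! h
    exact hne (funext h)
  have hev : deriv f =ᶠ[𝓝 z₀] fun _ ↦ 0 := by
    filter_upwards [(hd.continuous.sub hf.continuous).continuousAt.eventually_ne
      (sub_ne_zero.2 hz₀)] with z hz
    exact (mul_eq_zero.1 (hzero z)).resolve_right hz
  have hall := AnalyticOnNhd.eq_of_eventuallyEq (fun z _ ↦ hd.analyticAt z)
    (fun _ _ ↦ analyticAt_const) hev
  exact hnonconst ⟨f 0, fun z ↦ is_const_of_deriv_eq_zero hf (congrFun hall) z 0⟩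
end

section
/- Let a, b ∈ ℂ be distinct with b ≠ 0, and let f : ℂ → ℂ be a nonconstant entire function that partially shares both a and b with its derivative f'. Then one of the following holds: (a) f' = f identically; (b) there is a nonzero constant A ∈ ℂ such that f(z) = A·e^{bz/(b−a)} + a and a ≠ 0; (c) there is a nonzero constant A ∈ ℂ such that f(z) = A·e^{az/(a−b)} + b and a ≠ 0; (d) a = 0 and there is a nonzero constant A ∈ ℂ such that f(z) = b·((A/2)·e^{z/4} + 1)². -/
open Complex Metric Set Filter Topology

/-- Schwarz's lemma for a holomorphic map from a disc to the right half plane. -/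
lemma norm_sub_le_of_re_pos {L : ℂ → ℂ} {c : ℂ} {R : ℝ}
    (hL : DifferentiableOn ℂ L (ball c R)) (hre : ∀ z ∈ ball c R, 0 < (L z).re)
    {z : ℂ} (hz : z ∈ ball c R) :
    ‖L z - L c‖ ≤ ‖z - c‖ / R * ‖L z + (starRingEnd ℂ) (L c)‖ := by
  have hR : 0 < R := pos_of_mem_ball hz
  have hc : c ∈ ball c R := mem_ball_self hR
  have hne : ∀ w ∈ ball c R, L w + (starRingEnd ℂ) (L c) ≠ 0 := fun w hw h => by
    have h1 := hre w hw
    have h2 := hre c hc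
    have h3 := congrArg Complex.re h
    simp at h3
    linarith
  have hd : DifferentiableOn ℂ (fun w => (L w - L c) / (L w + (starRingEnd ℂ) (L c)))
      (ball c R) := (hL.sub_const _).div (hL.add_const _) hne
  have hmaps : MapsTo (fun w => (L w - L c) / (L w + (starRingEnd ℂ) (L c))) (ball c R)
      (closedBall ((L c - L c) / (L c + (starRingEnd ℂ) (L c))) 1) := by
    intro w hw
    have h1 := hre w hw
    have h2 := hre c hc
    simp only [sub_self, zero_div, mem_closedBall, dist_zero_right, norm_div]
    refine div_le_one_of_le₀ ?_ (norm_nonneg _)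
    rw [← abs_norm (L w - L c), ← abs_norm (L w + _), ← sq_le_sq, Complex.sq_norm,
      Complex.sq_norm, Complex.normSq_apply, Complex.normSq_apply]
    simp only [sub_re, sub_im, add_re, add_im, conj_re, conj_im]
    nlinarith [mul_pos h1 h2]
  have := Complex.dist_le_div_mul_dist_of_mapsTo_ball hd hmaps hz
  simp only [sub_self, zero_div, dist_eq_norm, sub_zero] at this
  rw [norm_div, div_le_iff₀ (norm_pos_iff.2 (hne z hz))] at this
  calc _ ≤ _ := this
    _ = _ := by ring

lemma norm_deriv_le_of_re_pos {L : ℂ → ℂ} {c : ℂ} {R : ℝ} (hR : 0 < R)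
    (hL : DifferentiableOn ℂ L (ball c R)) (hre : ∀ z ∈ ball c R, 0 < (L z).re) :
    ‖deriv L c‖ ≤ 2 * (L c).re / R := by
  have hd : HasDerivAt L (deriv L c) c :=
    (hL.differentiableAt (ball_mem_nhds c hR)).hasDerivAt
  have h1 : Tendsto (fun z => ‖slope L c z‖) (𝓝[≠] c) (𝓝 ‖deriv L c‖) :=
    (hasDerivAt_iff_tendsto_slope.1 hd).norm
  have h2 : Tendsto (fun z => ‖L z + (starRingEnd ℂ) (L c)‖ / R) (𝓝[≠] c)
      (𝓝 (‖L c + (starRingEnd ℂ) (L c)‖ / R)) :=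
    ((hd.continuousAt.tendsto.mono_left nhdsWithin_le_nhds).add_const _).norm.div_const _
  have h3 : ‖L c + (starRingEnd ℂ) (L c)‖ = 2 * (L c).re := by
    rw [Complex.add_conj, Complex.norm_real, Real.norm_of_nonneg]
    linarith [hre c (mem_ball_self hR)]
  rw [h3] at h2
  refine le_of_tendsto_of_tendsto h1 h2 ?_
  filter_upwards [self_mem_nhdsWithin, nhdsWithin_le_nhds (ball_mem_nhds c hR)] with z hz hzR
  have hz' : 0 < ‖z - c‖ := norm_pos_iff.2 (sub_ne_zero.2 hz)
  have := norm_sub_le_of_re_pos hL hre hzR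
  rw [slope_def_field, norm_div, div_le_iff₀ hz']
  calc _ ≤ _ := this
    _ = _ := by ring

/-- Harnack's inequality for the real part of a holomorphic function. -/
lemma harnack_of_re_pos {L : ℂ → ℂ} {c : ℂ} {R : ℝ}
    (hL : DifferentiableOn ℂ L (ball c R)) (hre : ∀ z ∈ ball c R, 0 < (L z).re)
    {z : ℂ} (hz : z ∈ ball c R) :
    (L c).re * (1 - ‖z - c‖ / R) ≤ (L z).re * (1 + ‖z - c‖ / R) := by
  have hR : 0 < R := pos_of_mem_ball hz
  have h := norm_sub_le_of_re_pos hL hre hz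
  have h1 := hre z hz
  have h2 := hre c (mem_ball_self hR)
  set t := ‖z - c‖ / R with ht
  have ht0 : 0 ≤ t := by positivity
  have ht1 : t < 1 := by
    rw [ht, div_lt_one hR]
    simpa [dist_eq_norm] using hz
  have h3 := pow_le_pow_left₀ (norm_nonneg _) h 2
  rw [mul_pow, Complex.sq_norm, Complex.sq_norm, Complex.normSq_apply, Complex.normSq_apply] at h3
  simp only [sub_re, sub_im, add_re, add_im, conj_re, conj_im] at h3
  have h4 : ((L c).re - (L z).re) ^ 2 ≤ (t * ((L z).re + (L c).re)) ^ 2 := by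
    have : 0 ≤ (1 - t ^ 2) * ((L z).im - (L c).im) ^ 2 :=
      mul_nonneg (by nlinarith) (sq_nonneg _)
    nlinarith
  have h5 := abs_le_of_sq_le_sq h4 (by positivity)
  linarith [(abs_le.1 h5).2]

/-- A zero-free holomorphic function on a disc is an exponential. -/
lemma exists_log_on_ball {G : ℂ → ℂ} {c : ℂ} {R : ℝ}
    (hG : DifferentiableOn ℂ G (ball c R)) (h0 : ∀ z ∈ ball c R, G z ≠ 0) :
    ∃ L : ℂ → ℂ, (∀ z ∈ ball c R, HasDerivAt L (deriv G z / G z) z) ∧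
      ∀ z ∈ ball c R, exp (L z) = G z := by
  rcases le_or_gt R 0 with hR | hR
  · exact ⟨0, by simp [ball_eq_empty.2 hR], by simp [ball_eq_empty.2 hR]⟩
  have hc : c ∈ ball c R := mem_ball_self hR
  have hq : DifferentiableOn ℂ (fun z => deriv G z / G z) (ball c R) :=
    (hG.deriv isOpen_ball).div hG h0
  obtain ⟨L, hLc, hL⟩ := hq.isExactOn_ball.with_val_at c (log (G c))
  refine ⟨L, hL, fun z hz => ?_⟩
  have hconst : ∀ w ∈ ball c R, HasDerivAt (fun w => G w * exp (-L w)) 0 w := fun w hw => by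
    have h1 := (hG.differentiableAt (isOpen_ball.mem_nhds hw)).hasDerivAt
    refine (h1.mul (hL w hw).neg.cexp).congr_deriv ?_
    field_simp [h0 w hw]
    ring
  have h := (convex_ball c R).is_const_of_fderivWithin_eq_zero (𝕜 := ℂ)
    (f := fun w => G w * exp (-L w))
    (fun w hw => (hconst w hw).differentiableAt.differentiableWithinAt)
    (fun w hw => by
      rw [fderivWithin_of_isOpen isOpen_ball hw]
      have := (hconst w hw).hasFDerivAt.fderiv
      simpa using! this) hz hc
  simp only [hLc, exp_neg, exp_log (h0 c hc), mul_inv_cancel₀ (h0 c hc)] at h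
  have he := exp_ne_zero (L z)
  field_simp at h
  exact h.symm

lemma norm_deriv_le_of_one_lt_norm {G : ℂ → ℂ} {c : ℂ} {R : ℝ} (hR : 0 < R)
    (hG : DifferentiableOn ℂ G (ball c R)) (h1 : ∀ z ∈ ball c R, 1 < ‖G z‖) :
    ‖deriv G c‖ ≤ 2 * Real.log ‖G c‖ / R * ‖G c‖ ∧
    ∀ z ∈ ball c R,
      Real.log ‖G c‖ * (1 - ‖z - c‖ / R) ≤ Real.log ‖G z‖ * (1 + ‖z - c‖ / R) := by
  have h0 : ∀ z ∈ ball c R, G z ≠ 0 := fun z hz => norm_pos_iff.1 (by linarith [h1 z hz])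
  obtain ⟨L, hL, hexp⟩ := exists_log_on_ball hG h0
  have hLre : ∀ z ∈ ball c R, (L z).re = Real.log ‖G z‖ := fun z hz => by
    rw [← hexp z hz, Complex.norm_exp, Real.log_exp]
  have hre : ∀ z ∈ ball c R, 0 < (L z).re := fun z hz => by
    rw [hLre z hz]; exact Real.log_pos (h1 z hz)
  have hc : c ∈ ball c R := mem_ball_self hR
  have hLd : DifferentiableOn ℂ L (ball c R) :=
    fun z hz => (hL z hz).differentiableAt.differentiableWithinAt
  refine ⟨?_, fun z hz => ?_⟩
  · have := norm_deriv_le_of_re_pos hR hLd hre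
    rw [(hL c hc).deriv, norm_div, hLre c hc, div_le_iff₀ (norm_pos_iff.2 (h0 c hc))] at this
    exact this
  · have := harnack_of_re_pos hLd hre hz
    rwa [hLre c hc, hLre z hz] at this

/-- If `‖G‖ > 1` on a disc and `‖G w‖ = 1` at a boundary point `w`, then the logarithmic derivative
of `G` at the centre is controlled by the derivative at `w`. -/
lemma norm_deriv_le_of_boundary {G : ℂ → ℂ} {c w : ℂ} {R : ℝ} (hR : 0 < R)
    (hG : DifferentiableOn ℂ G (ball c R)) (h1 : ∀ z ∈ ball c R, 1 < ‖G z‖)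
    (hw : dist w c = R) (hGw : ‖G w‖ = 1) (hd : DifferentiableAt ℂ G w) :
    ‖deriv G c‖ ≤ 4 * ‖deriv G w‖ * ‖G c‖ := by
  obtain ⟨hA, hB⟩ := norm_deriv_le_of_one_lt_norm hR hG h1
  have hwc : ‖w - c‖ = R := by rw [← dist_eq_norm, hw]
  suffices h : Real.log ‖G c‖ / 2 ≤ ‖deriv G w‖ * R by
    refine hA.trans (mul_le_mul_of_nonneg_right ?_ (norm_nonneg _))
    rw [div_le_iff₀ hR]
    linarith
  have hline : HasDerivAt (fun t : ℝ => G (c + (t : ℂ) * (w - c))) (deriv G w * (w - c)) 1 := by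
    have h2 : HasDerivAt (fun t : ℝ => c + (t : ℂ) * (w - c)) (w - c) 1 := by
      simpa using ((Complex.ofRealCLM.hasDerivAt (x := (1 : ℝ))).mul_const (w - c)).const_add c
    have h3 : HasDerivAt G (deriv G w) (c + ((1 : ℝ) : ℂ) * (w - c)) := by
      simpa using hd.hasDerivAt
    exact h3.comp_of_eq (1 : ℝ) h2 rfl
  have hs := (hasDerivAt_iff_tendsto_slope.1 hline).norm
  rw [norm_mul, hwc] at hs
  have hs' := hs.mono_left (nhdsWithin_mono (1 : ℝ) (s := Iio 1) (fun t ht => ne_of_lt ht))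
  refine ge_of_tendsto hs' ?_
  filter_upwards [Ioo_mem_nhdsLT (show (0 : ℝ) < 1 by norm_num)] with t ht
  have hnorm : ‖c + (t : ℂ) * (w - c) - c‖ = t * R := by
    rw [add_sub_cancel_left, norm_mul, hwc, Complex.norm_real, Real.norm_of_nonneg ht.1.le]
  have hmem : c + (t : ℂ) * (w - c) ∈ ball c R := by
    rw [mem_ball, dist_eq_norm, hnorm]
    nlinarith [ht.2]
  have h4 := hB _ hmem
  rw [hnorm, mul_div_assoc, div_self hR.ne', mul_one] at h4
  set v := c + (t : ℂ) * (w - c)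
  have h5 : Real.log ‖G v‖ ≤ ‖G v‖ - 1 := Real.log_le_sub_one_of_pos (by linarith [h1 v hmem])
  have h6 : ‖G v‖ - 1 ≤ ‖G v - G w‖ := by rw [← hGw]; exact norm_sub_norm_le _ _
  have h7 : 0 < Real.log ‖G v‖ := Real.log_pos (h1 v hmem)
  have h8 : Real.log ‖G c‖ * (1 - t) ≤ 2 * ‖G v - G w‖ := by nlinarith [ht.1, ht.2]
  have ht1 : ‖t - 1‖ = 1 - t := by
    rw [Real.norm_eq_abs, abs_sub_comm, abs_of_pos]
    linarith [ht.2]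
  rw [slope_def_module, norm_smul, norm_inv, ht1, inv_mul_eq_div,
    le_div_iff₀ (by linarith [ht.2])]
  simp only [ofReal_one, one_mul, add_sub_cancel]
  linarith

/-- An entire function whose derivative is bounded on the level set `‖F‖ = 1` has bounded
logarithmic derivative on `‖F‖ > 1`. -/
lemma norm_deriv_le_of_level_one {F : ℂ → ℂ} (hF : Differentiable ℂ F) {C : ℝ} (hC0 : 0 ≤ C)
    (hC : ∀ z, ‖F z‖ = 1 → ‖deriv F z‖ ≤ C) {z : ℂ} (hz : 1 < ‖F z‖) :
    ‖deriv F z‖ ≤ 4 * C * ‖F z‖ := by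
  have hclosed : IsClosed {w | ‖F w‖ ≤ 1} := isClosed_le hF.continuous.norm continuous_const
  rcases Set.eq_empty_or_nonempty {w | ‖F w‖ ≤ 1} with he | hne
  · have hgt : ∀ w, 1 < ‖F w‖ := fun w => by
      by_contra h
      have : w ∈ {w | ‖F w‖ ≤ 1} := not_lt.1 h
      simp [he] at this
    have hne0 : ∀ w, F w ≠ 0 := fun w => norm_pos_iff.1 (by linarith [hgt w])
    have hinv : Differentiable ℂ (fun w => (F w)⁻¹) := hF.inv hne0
    obtain ⟨k, hk⟩ := hinv.exists_const_forall_eq_of_bounded (by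
      refine (isBounded_closedBall (x := (0 : ℂ)) (r := 1)).subset ?_
      rintro _ ⟨w, rfl⟩
      simpa using inv_le_one_of_one_le₀ (hgt w).le)
    have hconst : F = fun _ => k⁻¹ := funext fun w => by rw [← hk w, inv_inv]
    rw [hconst]
    simp only [deriv_const, norm_zero]
    positivity
  · obtain ⟨w, hw, hdist⟩ := hclosed.exists_infDist_eq_dist hne z
    set R := dist z w with hRdef
    have hzw : z ≠ w := by
      rintro rfl
      exact absurd hw (not_le.2 hz)
    have hR : 0 < R := dist_pos.2 hzw
    have hball : ∀ v ∈ ball z R, 1 < ‖F v‖ := fun v hv => by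
      by_contra h
      have h1 := infDist_le_dist_of_mem (x := z) (show v ∈ {w | ‖F w‖ ≤ 1} from not_lt.1 h)
      rw [mem_ball, dist_comm] at hv
      linarith
    have hw1 : ‖F w‖ = 1 := by
      refine le_antisymm hw ?_
      have hcl : w ∈ closure (ball z R) := by
        rw [closure_ball z hR.ne', mem_closedBall, dist_comm]
      exact closure_minimal (fun v hv => (hball v hv).le)
        (isClosed_le continuous_const hF.continuous.norm) hcl
    have := norm_deriv_le_of_boundary hR hF.differentiableOn hball (dist_comm w z) hw1 (hF w)
    refine this.trans (mul_le_mul_of_nonneg_right ?_ (norm_nonneg _))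
    linarith [hC w hw1]

/-- A zero-free entire function with derivative bounded on the level set `‖g‖ = 1` satisfies
`g' = k g` for a constant `k`. -/
lemma exists_deriv_eq_const_mul {g : ℂ → ℂ} (hg : Differentiable ℂ g) (h0 : ∀ z, g z ≠ 0) {C : ℝ}
    (hC : ∀ z, ‖g z‖ = 1 → ‖deriv g z‖ ≤ C) : ∃ k : ℂ, ∀ z, deriv g z = k * g z := by
  wlog hC0 : 0 ≤ C generalizing C
  · exact this (C := |C|) (fun z hz => (hC z hz).trans (le_abs_self C)) (abs_nonneg C)
  have hinv : Differentiable ℂ (fun w => (g w)⁻¹) := hg.inv h0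
  have hdinv : ∀ z, ‖deriv (fun w => (g w)⁻¹) z‖ = ‖deriv g z‖ / ‖g z‖ ^ 2 := fun z => by
    rw [deriv_fun_inv'' (hg z) (h0 z), norm_div, norm_neg, norm_pow]
  have hbound : ∀ z, ‖deriv g z / g z‖ ≤ 4 * C := fun z => by
    have hpos := norm_pos_iff.2 (h0 z)
    rw [norm_div, div_le_iff₀ hpos]
    rcases lt_trichotomy ‖g z‖ 1 with h | h | h
    · have := norm_deriv_le_of_level_one hinv hC0 (fun w hw => by
        rw [norm_inv, inv_eq_one] at hw
        rw [hdinv, hw]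
        simpa using hC w hw) (z := z) (by rw [norm_inv]; exact (one_lt_inv₀ hpos).2 h)
      rw [hdinv, norm_inv, div_le_iff₀ (by positivity)] at this
      calc _ ≤ _ := this
        _ = _ := by field_simp
    · rw [h]
      linarith [hC z h]
    · exact norm_deriv_le_of_level_one hg hC0 hC h
  have hq : Differentiable ℂ (fun z => deriv g z / g z) := hg.deriv.div hg h0
  obtain ⟨k, hk⟩ := hq.exists_const_forall_eq_of_bounded (by
    refine (isBounded_closedBall (x := (0 : ℂ)) (r := 4 * C)).subset ?_
    rintro _ ⟨w, rfl⟩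
    simpa using hbound w)
  exact ⟨k, fun z => by rw [← hk z, div_mul_cancel₀ _ (h0 z)]⟩

/-- An entire function that omits the value `w` and whose derivative is bounded on bounded level
sets satisfies `f' = k (f - w)` for a constant `k`. -/
lemma exists_deriv_eq_of_omits {f : ℂ → ℂ} (hf : Differentiable ℂ f)
    (hbd : ∀ K : ℝ, ∃ C : ℝ, ∀ z, ‖f z‖ ≤ K → ‖deriv f z‖ ≤ C) {w : ℂ} (hw : ∀ z, f z ≠ w) :
    ∃ k : ℂ, ∀ z, deriv f z = k * (f z - w) := by
  obtain ⟨C, hC⟩ := hbd (1 + ‖w‖)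
  have hd : ∀ z, deriv (fun z => f z - w) z = deriv f z := fun z => deriv_sub_const w
  obtain ⟨k, hk⟩ := exists_deriv_eq_const_mul (hf.sub_const w) (fun z => sub_ne_zero.2 (hw z))
    (C := C) (fun z hz => by
      rw [hd]
      refine hC z ?_
      calc ‖f z‖ = ‖(f z - w) + w‖ := by simp
        _ ≤ ‖f z - w‖ + ‖w‖ := norm_add_le _ _
        _ = _ := by rw [hz])
  exact ⟨k, fun z => by rw [← hd, hk]⟩

/-- Entire functions divide when they divide locally. -/
lemma exists_entire_quotient {u v : ℂ → ℂ} (hv : ∀ z, ∀ᶠ w in 𝓝[≠] z, v w ≠ 0)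
    (hloc : ∀ z, ∃ k : ℂ → ℂ, AnalyticAt ℂ k z ∧ ∀ᶠ w in 𝓝 z, u w = k w * v w) :
    ∃ q : ℂ → ℂ, Differentiable ℂ q ∧ ∀ z, u z = q z * v z := by
  choose k hk hku using hloc
  refine ⟨fun z => k z z, fun z => ?_, fun z => (hku z).self_of_nhds⟩
  refine ((hk z).differentiableAt).congr_of_eventuallyEq ?_
  have h := eventually_nhdsWithin_iff.1 (hv z)
  filter_upwards [h, hku z] with w hw hkw
  rcases eq_or_ne w z with rfl | hne
  · rfl
  · have := (hku w).self_of_nhds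
    exact mul_right_cancel₀ (hw hne) (this.symm.trans hkw)

lemma eventually_ne_of_nonconst {f : ℂ → ℂ} (hf : Differentiable ℂ f)
    (hnc : ¬ ∃ c : ℂ, ∀ z : ℂ, f z = c) (c z : ℂ) : ∀ᶠ w in 𝓝[≠] z, f w ≠ c := by
  rcases (hf.analyticAt z).eventually_eq_or_eventually_ne (analyticAt_const (v := c)) with h | h
  · refine absurd ⟨c, fun w => ?_⟩ hnc
    have h1 : AnalyticOnNhd ℂ f univ := fun w _ => hf.analyticAt w
    have h2 : AnalyticOnNhd ℂ (fun _ : ℂ => c) univ := fun w _ => analyticAt_const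
    exact h1.eqOn_of_preconnected_of_eventuallyEq h2 isPreconnected_univ (mem_univ z) h (mem_univ w)
  · exact h

lemma differentiable_dslope {f : ℂ → ℂ} (hf : Differentiable ℂ f) (z : ℂ) :
    Differentiable ℂ (dslope f z) :=
  differentiableOn_univ.1 ((Complex.differentiableOn_dslope univ_mem).2 hf.differentiableOn)

lemma dslope_mul_eq (f : ℂ → ℂ) (z w : ℂ) : f w = dslope f z w * (w - z) + f z := by
  have := sub_smul_dslope f z w
  rw [smul_eq_mul] at this
  linear_combination -this

/-- At a simple `c`-point of `f`, any entire `u` vanishing there is locally divisible by `f - c`. -/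
lemma exists_local_quotient {f u : ℂ → ℂ} (hf : Differentiable ℂ f) (hu : Differentiable ℂ u)
    {c z : ℂ} (hz : f z = c) (hd : deriv f z ≠ 0) (huz : u z = 0) :
    ∃ k : ℂ → ℂ, AnalyticAt ℂ k z ∧ ∀ᶠ w in 𝓝 z, u w = k w * (f w - c) := by
  have hA := (differentiable_dslope hf z).analyticAt z
  have h0 : dslope f z z ≠ 0 := by rwa [dslope_same]
  refine ⟨fun w => dslope u z w / dslope f z w,
    ((differentiable_dslope hu z).analyticAt z).div hA h0, ?_⟩
  filter_upwards [hA.continuousAt.eventually_ne h0] with w hw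
  rw [dslope_mul_eq f z w, dslope_mul_eq u z w, huz, hz]
  field_simp
  ring

lemma exists_shift_quotient {b : ℂ} (hb : b ≠ 0) {f : ℂ → ℂ} (hf : Differentiable ℂ f)
    (hnc : ¬ ∃ c : ℂ, ∀ z : ℂ, f z = c) (hsb : ∀ z : ℂ, f z = b → deriv f z = b) :
    ∃ q : ℂ → ℂ, Differentiable ℂ q ∧ ∀ z, deriv f z - b = q z * (f z - b) := by
  refine exists_entire_quotient (fun z => ?_) fun z => ?_
  · filter_upwards [eventually_ne_of_nonconst hf hnc b z] with w hw using sub_ne_zero.2 hw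
  by_cases hz : f z = b
  · exact exists_local_quotient hf (hf.deriv.sub_const b) hz (by rwa [hsb z hz])
      (sub_eq_zero.2 (hsb z hz))
  · have hz' := sub_ne_zero.2 hz
    refine ⟨fun w => (deriv f w - b) / (f w - b), ((hf.deriv.sub_const b).analyticAt z).div
      ((hf.sub_const b).analyticAt z) hz', ?_⟩
    filter_upwards [(hf.sub_const b).continuous.continuousAt.eventually_ne hz'] with w hw
    rw [div_mul_cancel₀ _ hw]

/-- At a multiple zero of `f`, the product `f' (f' - f)` is locally divisible by `f`. -/
lemma exists_local_quotient_of_multiple {f : ℂ → ℂ} (hf : Differentiable ℂ f)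
    (hnc : ¬ ∃ c : ℂ, ∀ z : ℂ, f z = c) {z : ℂ} (hz : f z = 0) (hd : deriv f z = 0) :
    ∃ k : ℂ → ℂ, AnalyticAt ℂ k z ∧
      ∀ᶠ w in 𝓝 z, deriv f w * (deriv f w - f w) = k w * f w := by
  have hne : analyticOrderAt f z ≠ ⊤ := fun h => by
    have h1 := analyticOrderAt_eq_top.1 h
    have h2 := eventually_ne_of_nonconst hf hnc 0 z
    obtain ⟨w, hw1, hw2⟩ := (h2.and (h1.filter_mono nhdsWithin_le_nhds)).exists
    exact hw1 hw2
  obtain ⟨h, hh, hh0, hfh⟩ := (hf.analyticAt z).analyticOrderAt_ne_top.1 hne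
  set m := analyticOrderNatAt f z
  simp only [smul_eq_mul] at hfh
  have hder : ∀ᶠ w in 𝓝 z, deriv f w = m * (w - z) ^ (m - 1) * h w + (w - z) ^ m * deriv h w := by
    filter_upwards [hfh.eventually_nhds, hh.eventually_analyticAt] with w hw hhw
    have h1 : HasDerivAt (fun w => (w - z) ^ m * h w)
        (m * (w - z) ^ (m - 1) * h w + (w - z) ^ m * deriv h w) w := by
      have := (((hasDerivAt_id w).sub_const z).pow m).mul hhw.differentiableAt.hasDerivAt
      simpa using! this
    exact (h1.congr_of_eventuallyEq hw).deriv
  have hm : 2 ≤ m := by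
    by_contra hlt
    have h3 := hfh.self_of_nhds
    have h4 := hder.self_of_nhds
    simp only [hz, sub_self] at h3
    rw [hd, sub_self] at h4
    have hm01 : m = 0 ∨ m = 1 := by omega
    rcases hm01 with h5 | h5
    · simp [h5, hh0.symm] at h3
    · simp [h5, hh0.symm] at h4
  obtain ⟨n, hn⟩ : ∃ n, m = n + 2 := ⟨m - 2, by omega⟩
  have hs : AnalyticAt ℂ (fun w => (m : ℂ) * h w + (w - z) * deriv h w) z := by fun_prop
  refine ⟨fun w => (w - z) ^ n * ((m : ℂ) * h w + (w - z) * deriv h w) *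
    ((m : ℂ) * h w + (w - z) * deriv h w - (w - z) * h w) / h w, ?_, ?_⟩
  · have : AnalyticAt ℂ (fun w => (w - z) ^ n) z := by fun_prop
    exact ((this.mul hs).mul (hs.sub (by fun_prop))).div hh hh0
  · filter_upwards [hfh, hder, hh.continuousAt.eventually_ne hh0] with w h1 h2 h3
    rw [h2, h1]
    rw [hn]
    have : n + 2 - 1 = n + 1 := by omega
    rw [this]
    field_simp
    ring

lemma exists_product_quotient {a b : ℂ} (hab : a ≠ b) (hb : b ≠ 0) {f : ℂ → ℂ}
    (hf : Differentiable ℂ f) (hnc : ¬ ∃ c : ℂ, ∀ z : ℂ, f z = c)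
    (hsa : ∀ z : ℂ, f z = a → deriv f z = a) (hsb : ∀ z : ℂ, f z = b → deriv f z = b) :
    ∃ q : ℂ → ℂ, Differentiable ℂ q ∧
      ∀ z, deriv f z * (deriv f z - f z) = q z * ((f z - a) * (f z - b)) := by
  have hu : Differentiable ℂ (fun z => deriv f z * (deriv f z - f z)) :=
    hf.deriv.mul (hf.deriv.sub hf)
  have key : ∀ {c d z : ℂ} (_ : c ≠ d) (_ : f z = c) (_ : ∃ k : ℂ → ℂ, AnalyticAt ℂ k z ∧
      ∀ᶠ w in 𝓝 z, deriv f w * (deriv f w - f w) = k w * (f w - c)),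
      ∃ k : ℂ → ℂ, AnalyticAt ℂ k z ∧
      ∀ᶠ w in 𝓝 z, deriv f w * (deriv f w - f w) = k w * ((f w - c) * (f w - d)) := by
    rintro c d z hcd hz ⟨k, hk, hkw⟩
    have hz' : f z - d ≠ 0 := sub_ne_zero.2 (hz ▸ hcd)
    refine ⟨fun w => k w / (f w - d), hk.div ((hf.sub_const d).analyticAt z) hz', ?_⟩
    filter_upwards [hkw, (hf.sub_const d).continuous.continuousAt.eventually_ne hz'] with w h1 h2
    rw [h1]
    field_simp
  refine exists_entire_quotient (fun z => ?_) fun z => ?_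
  · filter_upwards [eventually_ne_of_nonconst hf hnc a z,
      eventually_ne_of_nonconst hf hnc b z] with w h1 h2
    exact mul_ne_zero (sub_ne_zero.2 h1) (sub_ne_zero.2 h2)
  by_cases hza : f z = a
  · refine key hab hza ?_
    by_cases ha : a = 0
    · subst ha
      simpa using exists_local_quotient_of_multiple hf hnc hza (hsa z hza)
    · exact exists_local_quotient hf hu hza (by rwa [hsa z hza]) (by simp [hsa z hza, hza])
  by_cases hzb : f z = b
  · obtain ⟨k, hk, hkw⟩ := key hab.symm hzb
      (exists_local_quotient hf hu hzb (by rwa [hsb z hzb]) (by simp [hsb z hzb, hzb]))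
    exact ⟨k, hk, by simpa only [mul_comm (f _ - a)] using hkw⟩
  have hne : (f z - a) * (f z - b) ≠ 0 := mul_ne_zero (sub_ne_zero.2 hza) (sub_ne_zero.2 hzb)
  have hv : Differentiable ℂ (fun z => (f z - a) * (f z - b)) :=
    (hf.sub_const a).mul (hf.sub_const b)
  refine ⟨fun w => deriv f w * (deriv f w - f w) / ((f w - a) * (f w - b)),
    (hu.analyticAt z).div (hv.analyticAt z) hne, ?_⟩
  filter_upwards [hv.continuous.continuousAt.eventually_ne hne] with w hw
  rw [div_mul_cancel₀ _ hw]

/-- Montel's theorem along an ultrafilter. -/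
lemma exists_tendstoLocallyUniformly_of_bounded {ι : Type*} (l : Ultrafilter ι) {f : ι → ℂ → ℂ}
    (hf : ∀ n, Differentiable ℂ (f n))
    (hb : ∀ r : ℝ, ∃ B : ℝ, ∀ᶠ n in (l : Filter ι), ∀ z, ‖z‖ ≤ r → ‖f n z‖ ≤ B) :
    ∃ F : ℂ → ℂ, TendstoLocallyUniformly f F l := by
  have hlim : ∀ z, ∃ y, Tendsto (fun n => f n z) l (𝓝 y) := fun z => by
    obtain ⟨B, hB⟩ := hb ‖z‖
    have h1 : closedBall (0 : ℂ) B ∈ (l.map (fun n => f n z) : Filter ℂ) := by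
      rw [Ultrafilter.coe_map, Filter.mem_map]
      filter_upwards [hB] with n hn
      simpa using hn z le_rfl
    obtain ⟨y, -, hy⟩ := (isCompact_closedBall (0 : ℂ) B).ultrafilter_le_nhds' _ h1
    exact ⟨y, hy⟩
  choose F hF using hlim
  refine ⟨F, ?_⟩
  rw [Metric.tendstoLocallyUniformly_iff]
  intro ε hε x
  obtain ⟨B, hB⟩ := hb (‖x‖ + 2)
  have hLip : ∀ᶠ n in (l : Filter ι), ∀ y ∈ ball x 1, ‖f n y - f n x‖ ≤ |B| * ‖y - x‖ := by
    filter_upwards [hB] with n hn y hy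
    refine (convex_ball x 1).norm_image_sub_le_of_norm_deriv_le (𝕜 := ℂ)
      (fun w _ => hf n w) (fun w hw => ?_) (mem_ball_self one_pos) hy
    have := Complex.norm_deriv_le_of_forall_mem_sphere_norm_le (c := w) (C := |B|) one_pos
      (hf n).diffContOnCl (fun v hv => (hn v ?_).trans (le_abs_self B))
    · simpa using this
    · have h1 : ‖v - w‖ = 1 := by simpa [dist_eq_norm] using hv
      have h2 : ‖w - x‖ < 1 := by simpa [dist_eq_norm] using hw
      calc ‖v‖ = ‖(v - w) + (w - x) + x‖ := by ring_nf
        _ ≤ ‖v - w‖ + ‖w - x‖ + ‖x‖ := norm_add₃_le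
        _ ≤ _ := by linarith
  have hFLip : ∀ y ∈ ball x 1, ‖F y - F x‖ ≤ |B| * ‖y - x‖ := fun y hy =>
    le_of_tendsto ((hF y).sub (hF x)).norm (hLip.mono fun n hn => hn y hy)
  set δ := min 1 (ε / (3 * (|B| + 1))) with hδ
  have hδ0 : 0 < δ := by positivity
  refine ⟨ball x δ, ball_mem_nhds x hδ0, ?_⟩
  filter_upwards [hLip, (Metric.tendsto_nhds.1 (hF x)) (ε / 3) (by positivity)] with n h1 h2 y hy
  have hy1 : y ∈ ball x 1 := ball_subset_ball (min_le_left _ _) hy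
  have hyδ : |B| * ‖y - x‖ ≤ ε / 3 := by
    have h3 : ‖y - x‖ ≤ ε / (3 * (|B| + 1)) := by
      have : ‖y - x‖ < δ := by simpa [dist_eq_norm] using hy
      exact this.le.trans (min_le_right _ _)
    rw [le_div_iff₀ (by positivity)] at h3
    nlinarith [norm_nonneg (y - x), abs_nonneg B]
  have h3 := h1 y hy1
  have h4 := hFLip y hy1
  rw [dist_eq_norm] at h2 ⊢
  calc ‖F y - f n y‖ = ‖(F y - F x) - (f n y - f n x) - (f n x - F x)‖ := by ring_nf
    _ ≤ ‖F y - F x‖ + ‖f n y - f n x‖ + ‖f n x - F x‖ :=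
      (norm_sub_le _ _).trans (add_le_add_left (norm_sub_le _ _) _)
    _ < ε := by linarith

/-- Divisibility with entire quotients yields a local bound in the limit. -/
lemma exists_ball_norm_le_of_quotient {ι : Type*} {l : Filter ι} [l.NeBot] {u v q : ι → ℂ → ℂ}
    {U V : ℂ → ℂ} (hu : TendstoLocallyUniformly u U l) (hv : TendstoLocallyUniformly v V l)
    (hU : Continuous U) (hV : Continuous V) (hq : ∀ n, Differentiable ℂ (q n))
    (huv : ∀ n z, u n z = q n z * v n z) {x : ℂ} (hx : ∀ᶠ w in 𝓝[≠] x, V w ≠ 0) :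
    ∃ r > 0, ∃ M : ℝ, (∀ z ∈ sphere x r, V z ≠ 0) ∧
      ∀ z ∈ closedBall x r, ‖U z‖ ≤ M * ‖V z‖ := by
  obtain ⟨ε, hε, hεV⟩ := Metric.eventually_nhds_iff.1 (eventually_nhdsWithin_iff.1 hx)
  have hr : 0 < ε / 2 := by positivity
  have hsV : ∀ z ∈ sphere x (ε / 2), V z ≠ 0 := fun z hz => by
    rw [mem_sphere] at hz
    exact hεV (by linarith) (by rintro rfl; simp at hz; linarith)
  have hcomp := isCompact_sphere x (ε / 2)
  have hnes : (sphere x (ε / 2)).Nonempty := NormedSpace.sphere_nonempty.2 hr.le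
  obtain ⟨y, hy, hymin⟩ := hcomp.exists_isMinOn hnes hV.norm.continuousOn
  obtain ⟨y', hy', hymax⟩ := hcomp.exists_isMaxOn hnes hU.norm.continuousOn
  have hδ : 0 < ‖V y‖ := norm_pos_iff.2 (hsV y hy)
  have h1 := Metric.tendstoUniformlyOn_iff.1
    ((tendstoLocallyUniformlyOn_iff_tendstoUniformlyOn_of_compact hcomp).1
      hu.tendstoLocallyUniformlyOn) 1 one_pos
  have h2 := Metric.tendstoUniformlyOn_iff.1
    ((tendstoLocallyUniformlyOn_iff_tendstoUniformlyOn_of_compact hcomp).1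
      hv.tendstoLocallyUniformlyOn) (‖V y‖ / 2) (by positivity)
  refine ⟨ε / 2, hr, (‖U y'‖ + 1) / (‖V y‖ / 2), hsV, fun z hz => ?_⟩
  refine le_of_tendsto_of_tendsto
    ((hu.tendstoLocallyUniformlyOn (s := univ)).tendsto_at (mem_univ z)).norm
    (((hv.tendstoLocallyUniformlyOn (s := univ)).tendsto_at (mem_univ z)).norm.const_mul
      ((‖U y'‖ + 1) / (‖V y‖ / 2))) ?_
  filter_upwards [h1, h2] with n hn1 hn2
  rw [huv, norm_mul]
  refine mul_le_mul_of_nonneg_right ?_ (norm_nonneg _)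
  refine Complex.norm_le_of_forall_mem_frontier_norm_le (U := ball x (ε / 2)) isBounded_ball
    (hq n).diffContOnCl (fun w hw => ?_) (by rwa [closure_ball x hr.ne'])
  rw [frontier_ball x hr.ne'] at hw
  have h3 : ‖V y‖ / 2 ≤ ‖v n w‖ := by
    have e1 := hn2 w hw
    have e2 : ‖V y‖ ≤ ‖V w‖ := hymin hw
    have e3 := norm_sub_norm_le (V w) (v n w)
    rw [dist_eq_norm] at e1
    linarith
  have h4 : ‖u n w‖ ≤ ‖U y'‖ + 1 := by
    have e1 := hn1 w hw
    have e2 : ‖U w‖ ≤ ‖U y'‖ := hymax hw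
    have e3 := norm_sub_norm_le (u n w) (U w)
    rw [dist_eq_norm, norm_sub_rev] at e1
    linarith
  rw [le_div_iff₀ (by positivity)]
  calc ‖q n w‖ * (‖V y‖ / 2) ≤ ‖q n w‖ * ‖v n w‖ := by gcongr
    _ = ‖u n w‖ := by rw [huv, norm_mul]
    _ ≤ _ := h4

/-- A function with `‖F'‖ ≤ M ‖F‖` on a closed disc that vanishes at the centre vanishes. -/
lemma eq_zero_of_norm_deriv_le {F : ℂ → ℂ} (hF : Differentiable ℂ F) {x y : ℂ} {r M : ℝ}
    (hM : ∀ z ∈ closedBall x r, ‖deriv F z‖ ≤ M * ‖F z‖) (hx : F x = 0)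
    (hy : y ∈ closedBall x r) : F y = 0 := by
  have hr : ‖y - x‖ ≤ r := by simpa [dist_eq_norm] using hy
  have hd : ∀ t : ℝ, HasDerivAt (fun t : ℝ => F (x + (t : ℂ) * (y - x)))
      (deriv F (x + (t : ℂ) * (y - x)) * (y - x)) t := fun t => by
    have h2 : HasDerivAt (fun t : ℝ => x + (t : ℂ) * (y - x)) (y - x) t := by
      simpa using ((Complex.ofRealCLM.hasDerivAt (x := t)).mul_const (y - x)).const_add x
    exact (hF _).hasDerivAt.comp_of_eq t h2 rfl
  have := eq_zero_of_abs_deriv_le_mul_abs_self_of_eq_zero_right (a := 0) (b := 1)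
    (K := M * ‖y - x‖) (fun t _ => (hd t).continuousAt.continuousWithinAt)
    (fun t _ => (hd t).hasDerivWithinAt) (by simpa using hx) (fun t ht => ?_) 1 (by simp)
  · simpa using this
  · have h3 : x + (t : ℂ) * (y - x) ∈ closedBall x r := by
      rw [mem_closedBall, dist_eq_norm, add_sub_cancel_left, norm_mul, Complex.norm_real,
        Real.norm_of_nonneg ht.1]
      nlinarith [ht.1, ht.2, norm_nonneg (y - x)]
    rw [norm_mul]
    calc _ ≤ M * ‖F (x + (t : ℂ) * (y - x))‖ * ‖y - x‖ := by gcongr; exact hM _ h3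
      _ = _ := by ring

/-- The size of the derivative measured in the metric `|dw|` weighted so that
`log log (e + |w|²)` is Lipschitz. -/
noncomputable def loglogDeriv (f : ℂ → ℂ) (z : ℂ) : ℝ :=
  ‖deriv f z‖ * (1 + ‖f z‖) / ((Real.exp 1 + ‖f z‖ ^ 2) * Real.log (Real.exp 1 + ‖f z‖ ^ 2))

lemma one_le_log_exp_one_add (w : ℂ) : 1 ≤ Real.log (Real.exp 1 + ‖w‖ ^ 2) := by
  rw [Real.le_log_iff_exp_le (by positivity)]
  nlinarith [norm_nonneg w]

lemma loglogDeriv_denom_pos (w : ℂ) :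
    0 < (Real.exp 1 + ‖w‖ ^ 2) * Real.log (Real.exp 1 + ‖w‖ ^ 2) :=
  mul_pos (by positivity) (zero_lt_one.trans_le (one_le_log_exp_one_add w))

lemma loglogDeriv_nonneg (f : ℂ → ℂ) (z : ℂ) : 0 ≤ loglogDeriv f z :=
  div_nonneg (by positivity) (loglogDeriv_denom_pos _).le

lemma continuous_loglogDeriv {f : ℂ → ℂ} (hf : Differentiable ℂ f) :
    Continuous (loglogDeriv f) := by
  have h1 : Continuous (deriv f) := hf.deriv.continuous
  have h2 := hf.continuous
  refine Continuous.div (by fun_prop) ?_ fun z => (loglogDeriv_denom_pos _).ne'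
  refine Continuous.mul (by fun_prop) (Continuous.log (by fun_prop) fun z => ?_)
  positivity

/-- A bound on `loglogDeriv` controls the growth of `log log`. -/
lemma abs_loglog_sub_le {F : ℂ → ℂ} (hF : Differentiable ℂ F) {R : ℝ}
    (hR : ∀ z, ‖z‖ ≤ R → loglogDeriv F z ≤ 2) {z : ℂ} (hz : ‖z‖ ≤ R) :
    |Real.log (Real.log (Real.exp 1 + ‖F z‖ ^ 2)) -
      Real.log (Real.log (Real.exp 1 + ‖F 0‖ ^ 2))| ≤ 4 * ‖z‖ := by
  have hd : ∀ t : ℝ, HasDerivAt (fun t : ℝ => F ((t : ℂ) * z)) (deriv F ((t : ℂ) * z) * z) t :=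
    fun t => by
      have h2 : HasDerivAt (fun t : ℝ => (t : ℂ) * z) z t := by
        simpa using ((Complex.ofRealCLM.hasDerivAt (x := t)).mul_const z)
      exact (hF _).hasDerivAt.comp_of_eq t h2 rfl
  have hd2 := fun t : ℝ => (((hd t).norm_sq.const_add (Real.exp 1)).log
    (by positivity)).log (zero_lt_one.trans_le (one_le_log_exp_one_add (F ((t : ℂ) * z)))).ne'
  have := (convex_Icc (0 : ℝ) 1).norm_image_sub_le_of_norm_hasDerivWithin_le (C := 4 * ‖z‖)
    (fun t _ => (hd2 t).hasDerivWithinAt) (fun t ht => ?_) (left_mem_Icc.2 zero_le_one)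
    (right_mem_Icc.2 zero_le_one)
  · simpa using this
  · set w := (t : ℂ) * z with hw
    have hwR : ‖w‖ ≤ R := by
      rw [hw, norm_mul, Complex.norm_real, Real.norm_of_nonneg ht.1]
      nlinarith [ht.1, ht.2, norm_nonneg z]
    have h1 := hR w hwR
    have hD := loglogDeriv_denom_pos (F w)
    rw [loglogDeriv, div_le_iff₀ hD] at h1
    rw [div_div, norm_div, Real.norm_of_nonneg hD.le, div_le_iff₀ hD]
    have h2 : ‖2 * inner ℝ (F w) (deriv F w * z)‖ ≤ 2 * (‖F w‖ * (‖deriv F w‖ * ‖z‖)) := by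
      rw [norm_mul, Real.norm_two, ← norm_mul]
      gcongr
      exact norm_inner_le_norm _ _
    refine h2.trans ?_
    have h3 : ‖deriv F w‖ * ‖F w‖ ≤ ‖deriv F w‖ * (1 + ‖F w‖) := by gcongr; linarith
    nlinarith [norm_nonneg z]

lemma norm_le_of_loglogDeriv_le {F : ℂ → ℂ} (hF : Differentiable ℂ F) {R : ℝ} (h4 : 4 ≤ R)
    (hR : ∀ z, ‖z‖ ≤ R → loglogDeriv F z ≤ 2) (h0 : loglogDeriv F 0 = 1) {z : ℂ}
    (hz : ‖z‖ ≤ R) : ‖F z‖ ≤ Real.exp (2 * Real.exp (16 + 4 * ‖z‖)) := by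
  set Λ : ℂ → ℝ := fun w => Real.log (Real.exp 1 + ‖w‖ ^ 2) with hΛ
  have hΛ1 : ∀ w, 0 < Λ w := fun w => zero_lt_one.trans_le (one_le_log_exp_one_add w)
  have hcmp : ∀ z, ‖z‖ ≤ R → |Real.log (Λ (F z)) - Real.log (Λ (F 0))| ≤ 4 * ‖z‖ :=
    fun z hz => abs_loglog_sub_le hF hR hz
  have hF0 : Λ (F 0) ≤ 2 * Real.exp 16 := by
    by_contra! hcon
    have hgt : ∀ w ∈ ball (0 : ℂ) 4, 1 < ‖F w‖ := fun w hw => by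
      have hw4 : ‖w‖ < 4 := by simpa using hw
      have h1 := (abs_le.1 (hcmp w (by linarith))).1
      have h2 : Real.log (2 * Real.exp 16) < Real.log (Λ (F 0)) :=
        Real.log_lt_log (by positivity) hcon
      rw [Real.log_mul (by norm_num) (by positivity), Real.log_exp] at h2
      have h3 : Real.log 2 < Real.log (Λ (F w)) := by linarith
      have h5 : 2 < Λ (F w) := (Real.log_lt_log_iff (by norm_num) (hΛ1 _)).1 h3
      rw [hΛ, Real.lt_log_iff_exp_lt (by positivity)] at h5
      have h6 : Real.exp 2 = Real.exp 1 * Real.exp 1 := by rw [← Real.exp_add]; norm_num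
      by_contra! h7
      have := Real.exp_one_gt_d9
      nlinarith [norm_nonneg (F w)]
    have h1 := (norm_deriv_le_of_one_lt_norm (by norm_num : (0:ℝ) < 4) hF.differentiableOn hgt).1
    have hm : 1 < ‖F 0‖ := hgt 0 (by simp)
    have hD := loglogDeriv_denom_pos (F 0)
    rw [loglogDeriv, div_eq_one_iff_eq hD.ne'] at h0
    have hlog : 2 * Real.log ‖F 0‖ ≤ Λ (F 0) := by
      have : 2 * Real.log ‖F 0‖ = Real.log (‖F 0‖ ^ 2) := by rw [Real.log_pow]; norm_num
      rw [this]
      exact Real.log_le_log (by positivity) (by linarith [Real.exp_pos 1])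
    have h2 : ‖deriv F 0‖ ≤ Λ (F 0) / 4 * ‖F 0‖ := by
      refine h1.trans ?_
      gcongr
    have h3 : ‖deriv F 0‖ * (1 + ‖F 0‖) ≤ Λ (F 0) / 4 * ‖F 0‖ * (1 + ‖F 0‖) := by gcongr
    have h5 : Λ (F 0) / 4 * ‖F 0‖ * (1 + ‖F 0‖) ≤ Λ (F 0) * ‖F 0‖ ^ 2 := by
      have : ‖F 0‖ * (1 + ‖F 0‖) ≤ 4 * ‖F 0‖ ^ 2 := by nlinarith
      nlinarith [hΛ1 (F 0)]
    have h6 : (Real.exp 1 + ‖F 0‖ ^ 2) * Λ (F 0) ≤ Λ (F 0) * ‖F 0‖ ^ 2 := by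
      rw [← h0]; exact h3.trans h5
    nlinarith [mul_pos (Real.exp_pos 1) (hΛ1 (F 0))]
  have h1 := (abs_le.1 (hcmp z hz)).2
  have h2 : Real.log (Λ (F 0)) ≤ Real.log (2 * Real.exp 16) := Real.log_le_log (hΛ1 _) hF0
  rw [Real.log_mul (by norm_num) (by positivity), Real.log_exp] at h2
  have h3 : Λ (F z) ≤ 2 * Real.exp (16 + 4 * ‖z‖) := by
    rw [← Real.exp_log (hΛ1 (F z)), ← Real.exp_log (by norm_num : (0:ℝ) < 2), ← Real.exp_add]
    exact Real.exp_le_exp.2 (by linarith)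
  rw [hΛ, Real.log_le_iff_le_exp (by positivity)] at h3
  refine le_trans ?_ h3
  nlinarith [sq_nonneg (‖F z‖ - 1), Real.exp_one_gt_d9]

lemma deriv_comp_affine {f : ℂ → ℂ} (hf : Differentiable ℂ f) (y c z : ℂ) :
    deriv (fun ζ => f (y + c * ζ)) z = c * deriv f (y + c * z) := by
  have h2 : HasDerivAt (fun ζ : ℂ => y + c * ζ) c z := by
    simpa using ((hasDerivAt_id z).const_mul c).const_add y
  rw [mul_comm]
  exact ((hf _).hasDerivAt.comp z h2).deriv

lemma loglogDeriv_comp_affine {f : ℂ → ℂ} (hf : Differentiable ℂ f) (y : ℂ) {c : ℝ}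
    (hc : 0 ≤ c) (z : ℂ) :
    loglogDeriv (fun ζ => f (y + c * ζ)) z = c * loglogDeriv f (y + c * z) := by
  rw [loglogDeriv, loglogDeriv, deriv_comp_affine hf, norm_mul, Complex.norm_real,
    Real.norm_of_nonneg hc]
  ring

/-- Rescaling an entire function whose `loglogDeriv` is unbounded. -/
lemma exists_rescaling_limit {f : ℂ → ℂ} (hf : Differentiable ℂ f)
    (hunb : ∀ C : ℝ, ∃ z, C < loglogDeriv f z) :
    ∃ (y : ℕ → ℂ) (ρ : ℕ → ℝ) (F : ℂ → ℂ), Tendsto ρ atTop (𝓝 0) ∧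
      (∀ n, 0 < ρ n) ∧
      TendstoLocallyUniformly (fun n ζ => f (y n + ρ n * ζ)) F (hyperfilter ℕ : Filter ℕ) ∧
      Differentiable ℂ F ∧
      TendstoLocallyUniformly (fun n ζ => ρ n * deriv f (y n + ρ n * ζ)) (deriv F)
        (hyperfilter ℕ : Filter ℕ) ∧
      loglogDeriv F 0 = 1 ∧ ∀ z, loglogDeriv F z ≤ 2 := by
  have hpt : ∀ n : ℕ, ∃ y : ℂ, ∃ ρ : ℝ, 0 < ρ ∧ ρ ≤ 1 / ((n : ℝ) + 1) ∧
      ρ * loglogDeriv f y = 1 ∧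
      ∀ ζ : ℂ, ‖ζ‖ ≤ (n : ℝ) + 1 → ρ * loglogDeriv f (y + ρ * ζ) ≤ 2 := fun n => by
    obtain ⟨x, hx⟩ := hunb ((n : ℝ) + 1)
    obtain ⟨ε, hε, y, hε1, -, h1, h2⟩ := hofer x 1 one_pos (continuous_loglogDeriv hf)
      (loglogDeriv_nonneg f)
    rw [one_mul] at h1
    have hn : (0 : ℝ) < n + 1 := by positivity
    have hεψ : (n : ℝ) + 1 < ε * loglogDeriv f y := hx.trans_le h1
    have hψ : (n : ℝ) + 1 < loglogDeriv f y := by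
      nlinarith [loglogDeriv_nonneg f y]
    have hψ0 : 0 < loglogDeriv f y := hn.trans hψ
    refine ⟨y, 1 / loglogDeriv f y, by positivity, by gcongr, by field_simp, fun ζ hζ => ?_⟩
    have h3 := h2 (y + ((1 / loglogDeriv f y : ℝ) : ℂ) * ζ) (by
      rw [dist_comm, dist_eq_norm, add_sub_cancel_left, norm_mul, Complex.norm_real,
        Real.norm_of_nonneg (by positivity), one_div, inv_mul_le_iff₀ hψ0]
      linarith)
    rw [one_div, inv_mul_le_iff₀ hψ0, ← one_div]
    linarith
  choose y ρ hρ0 hρ1 hρψ hρ2 using hpt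
  have hρlim : Tendsto ρ atTop (𝓝 0) :=
    squeeze_zero (fun n => (hρ0 n).le) hρ1 tendsto_one_div_add_atTop_nhds_zero_nat
  have hfn : ∀ n, Differentiable ℂ (fun ζ => f (y n + ρ n * ζ)) := fun n =>
    hf.comp (by fun_prop)
  have hψn : ∀ n ζ, loglogDeriv (fun ζ => f (y n + ρ n * ζ)) ζ =
      ρ n * loglogDeriv f (y n + ρ n * ζ) := fun n ζ =>
    loglogDeriv_comp_affine hf (y n) (hρ0 n).le ζ
  have hle : (hyperfilter ℕ : Filter ℕ) ≤ atTop := by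
    rw [← Nat.cofinite_eq_atTop]; exact hyperfilter_le_cofinite
  obtain ⟨F, hF⟩ := exists_tendstoLocallyUniformly_of_bounded (hyperfilter ℕ) hfn (fun r => by
    refine ⟨Real.exp (2 * Real.exp (16 + 4 * r)), ?_⟩
    have : ∀ᶠ n : ℕ in atTop, max 4 r ≤ (n : ℝ) + 1 :=
      (tendsto_atTop_add_const_right _ 1 tendsto_natCast_atTop_atTop).eventually_ge_atTop _
    filter_upwards [hle this] with n hn z hz
    refine (norm_le_of_loglogDeriv_le (hfn n) ((le_max_left _ _).trans hn)
      (fun z hz => ?_) ?_ (hz.trans ((le_max_right _ _).trans hn))).trans ?_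
    · rw [hψn]; exact hρ2 n z hz
    · rw [hψn]; simpa using hρψ n
    · gcongr)
  have hFu := hF.tendstoLocallyUniformlyOn (s := univ)
  have hFd : Differentiable ℂ F := differentiableOn_univ.1
    (hFu.differentiableOn (Eventually.of_forall fun n => (hfn n).differentiableOn) isOpen_univ)
  have hF' : TendstoLocallyUniformly (fun n ζ => ρ n * deriv f (y n + ρ n * ζ)) (deriv F)
      (hyperfilter ℕ : Filter ℕ) := by
    rw [← tendstoLocallyUniformlyOn_univ]
    refine (hFu.deriv (Eventually.of_forall fun n => (hfn n).differentiableOn)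
      isOpen_univ).congr fun n z _ => ?_
    exact deriv_comp_affine hf _ _ z
  have hlim : ∀ z, Tendsto (fun n => ρ n * loglogDeriv f (y n + ρ n * z))
      (hyperfilter ℕ : Filter ℕ) (𝓝 (loglogDeriv F z)) := fun z => by
    have h1 := (hFu.tendsto_at (mem_univ z)).norm
    have h2 := ((tendstoLocallyUniformlyOn_univ.2 hF').tendsto_at (mem_univ z)).norm
    have h3 := (h1.pow 2).const_add (Real.exp 1)
    have h4 := (h2.mul (h1.const_add 1)).div (h3.mul (h3.log (by positivity)))
      (loglogDeriv_denom_pos (F z)).ne'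
    refine h4.congr fun n => ?_
    rw [← hψn, loglogDeriv, deriv_comp_affine hf]
    rfl
  refine ⟨y, ρ, F, hρlim, hρ0, hF, hFd, hF', ?_, fun z => ?_⟩
  · refine tendsto_nhds_unique (hlim 0) (tendsto_const_nhds.congr fun n => ?_)
    simpa using (hρψ n).symm
  · refine le_of_tendsto (hlim z) ?_
    have : ∀ᶠ n : ℕ in atTop, ‖z‖ ≤ (n : ℝ) + 1 :=
      (tendsto_atTop_add_const_right _ 1 tendsto_natCast_atTop_atTop).eventually_ge_atTop _
    filter_upwards [hle this] with n hn
    exact hρ2 n z hn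

lemma exists_norm_deriv_le_of_loglogDeriv_le {f : ℂ → ℂ} {M : ℝ}
    (hM : ∀ z, loglogDeriv f z ≤ M) (K : ℝ) :
    ∃ C, ∀ z, ‖f z‖ ≤ K → ‖deriv f z‖ ≤ C := by
  refine ⟨M * ((Real.exp 1 + K ^ 2) * Real.log (Real.exp 1 + K ^ 2)), fun z hz => ?_⟩
  have h1 := hM z
  have hM0 : 0 ≤ M := (loglogDeriv_nonneg f z).trans h1
  have hD := loglogDeriv_denom_pos (f z)
  rw [loglogDeriv, div_le_iff₀ hD] at h1
  have hlog := one_le_log_exp_one_add (f z)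
  calc ‖deriv f z‖ ≤ ‖deriv f z‖ * (1 + ‖f z‖) := by
        nlinarith [norm_nonneg (deriv f z), norm_nonneg (f z),
          mul_nonneg (norm_nonneg (deriv f z)) (norm_nonneg (f z))]
    _ ≤ _ := h1
    _ ≤ _ := by gcongr

lemma eq_add_exp_of_deriv_eq {f : ℂ → ℂ} (hf : Differentiable ℂ f) {k w : ℂ}
    (h : ∀ z, deriv f z = k * (f z - w)) (z : ℂ) :
    f z = (f 0 - w) * Complex.exp (k * z) + w := by
  have hd : ∀ x, HasDerivAt (fun z => (f z - w) * Complex.exp (-(k * z))) 0 x := fun x => by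
    have h1 : HasDerivAt (fun z : ℂ => -(k * z)) (-k) x := by
      simpa using (hasDerivAt_id x).const_mul (-k)
    refine (((hf x).hasDerivAt.sub_const w).mul h1.cexp).congr_deriv ?_
    rw [h]; ring
  have hc := is_const_of_deriv_eq_zero (fun x => (hd x).differentiableAt)
    (fun x => (hd x).deriv) z 0
  simp only [mul_zero, neg_zero, Complex.exp_zero, mul_one] at hc
  rw [← hc, mul_assoc, ← Complex.exp_add]
  simp

lemma exists_eq_of_deriv_eq {f : ℂ → ℂ} (hf : Differentiable ℂ f) {k w : ℂ} (hk : k ≠ 0)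
    (h : ∀ z, deriv f z = k * (f z - w)) (h0 : f 0 ≠ w) {c : ℂ} (hc : c ≠ w) :
    ∃ z, f z = c := by
  have h1 := sub_ne_zero.2 h0
  refine ⟨Complex.log ((c - w) / (f 0 - w)) / k, ?_⟩
  rw [eq_add_exp_of_deriv_eq hf h, mul_div_cancel₀ _ hk,
    Complex.exp_log (div_ne_zero (sub_ne_zero.2 hc) h1)]
  field_simp
  ring

lemma tendstoLocallyUniformly_const_left {ι : Type*} {l : Filter ι} {c : ι → ℂ} {c₀ : ℂ}
    (hc : Tendsto c l (𝓝 c₀)) :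
    TendstoLocallyUniformly (fun n (_ : ℂ) => c n) (fun _ => c₀) l := by
  refine TendstoUniformly.tendstoLocallyUniformly ?_
  rw [Metric.tendstoUniformly_iff]
  intro ε hε
  filter_upwards [Metric.tendsto_nhds.1 hc ε hε] with n hn _
  rwa [dist_comm]

/-- An entire function partially sharing two values with its derivative has its derivative
bounded wherever the function is bounded. -/
lemma exists_norm_deriv_le_on_sublevel {a b : ℂ} (hab : a ≠ b) (hb : b ≠ 0) {f : ℂ → ℂ}
    (hf : Differentiable ℂ f) (hnc : ¬ ∃ c, ∀ z, f z = c)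
    (hsa : ∀ z, f z = a → deriv f z = a) (hsb : ∀ z, f z = b → deriv f z = b) (K : ℝ) :
    ∃ C, ∀ z, ‖f z‖ ≤ K → ‖deriv f z‖ ≤ C := by
  by_cases hunb : ∃ C : ℝ, ∀ z, loglogDeriv f z ≤ C
  · obtain ⟨M, hM⟩ := hunb
    exact exists_norm_deriv_le_of_loglogDeriv_le hM K
  push Not at hunb
  exfalso
  obtain ⟨y, ρ, F, hρ, hρ0, hF, hFd, hF', hF0, hF2⟩ := exists_rescaling_limit hf hunb
  have hle : (hyperfilter ℕ : Filter ℕ) ≤ atTop := by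
    rw [← Nat.cofinite_eq_atTop]; exact hyperfilter_le_cofinite
  have hF0' : deriv F 0 ≠ 0 := fun h => by simp [loglogDeriv, h] at hF0
  have hFnc : ¬ ∃ c, ∀ z, F z = c := by
    rintro ⟨c, hc⟩
    apply hF0'
    rw [show F = fun _ => c from funext hc, deriv_const]
  have hρc : Tendsto (fun n => (ρ n : ℂ)) (hyperfilter ℕ : Filter ℕ) (𝓝 0) := by
    have := (Complex.continuous_ofReal.tendsto 0).comp (hρ.mono_left hle)
    rwa [Complex.ofReal_zero] at this
  have hconst : ∀ c : ℂ, TendstoLocallyUniformly (fun (_ : ℕ) (_ : ℂ) => c) (fun _ => c)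
      (hyperfilter ℕ : Filter ℕ) := fun c =>
    tendstoLocallyUniformly_const_left tendsto_const_nhds
  have hρu := tendstoLocallyUniformly_const_left hρc
  have hFc := hFd.continuous
  have hF'c : Continuous (deriv F) := hFd.deriv.continuous
  have hFb : ∀ x, F x ≠ b := fun x hx => by
    obtain ⟨q, hq, hqe⟩ := exists_shift_quotient hb hf hnc hsb
    obtain ⟨r, hr, M, hs, hM⟩ := exists_ball_norm_le_of_quotient (x := x)
      (u := fun n ζ => ρ n * deriv f (y n + ρ n * ζ) - ρ n * b)
      (v := fun n ζ => f (y n + ρ n * ζ) - b)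
      (q := fun n ζ => ρ n * q (y n + ρ n * ζ)) (U := fun ζ => deriv F ζ - 0 * b)
      (V := fun ζ => F ζ - b)
      (hF'.sub (hρu.mul₀ (hconst b) continuous_const continuous_const))
      (hF.sub (hconst b)) (by fun_prop) (by fun_prop)
      (fun n => (hq.comp (by fun_prop)).const_mul _)
      (fun n z => by linear_combination ρ n * hqe (y n + ρ n * z))
      (by
        filter_upwards [eventually_ne_of_nonconst hFd hFnc b x] with w hw
        exact sub_ne_zero.2 hw)
    have hnes : (sphere x r).Nonempty := NormedSpace.sphere_nonempty.2 hr.le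
    obtain ⟨w, hw⟩ := hnes
    refine hs w hw (eq_zero_of_norm_deriv_le (F := fun ζ => F ζ - b) (x := x) (r := r) (M := M)
      (hFd.sub_const b) (fun z hz => ?_) (by simp [hx]) (sphere_subset_closedBall hw))
    simpa using hM z hz
  have hFa : ∀ x, F x = a → deriv F x = 0 := fun x hx => by
    obtain ⟨q, hq, hqe⟩ := exists_product_quotient hab hb hf hnc hsa hsb
    obtain ⟨r, hr, M, hs, hM⟩ := exists_ball_norm_le_of_quotient (x := x)
      (u := fun n ζ => (ρ n * deriv f (y n + ρ n * ζ)) *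
        (ρ n * deriv f (y n + ρ n * ζ) - ρ n * f (y n + ρ n * ζ)))
      (v := fun n ζ => (f (y n + ρ n * ζ) - a) * (f (y n + ρ n * ζ) - b))
      (q := fun n ζ => ρ n ^ 2 * q (y n + ρ n * ζ))
      (U := fun ζ => deriv F ζ * (deriv F ζ - 0 * F ζ)) (V := fun ζ => (F ζ - a) * (F ζ - b))
      (hF'.mul₀ (hF'.sub (hρu.mul₀ hF continuous_const hFc)) hF'c (by fun_prop))
      ((hF.sub (hconst a)).mul₀ (hF.sub (hconst b)) (by fun_prop) (by fun_prop))
      (by fun_prop) (by fun_prop)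
      (fun n => (hq.comp (by fun_prop)).const_mul _)
      (fun n z => by linear_combination (ρ n : ℂ) ^ 2 * hqe (y n + ρ n * z))
      (by
        filter_upwards [eventually_ne_of_nonconst hFd hFnc a x] with w hw
        exact mul_ne_zero (sub_ne_zero.2 hw) (sub_ne_zero.2 (hFb w)))
    have := hM x (mem_closedBall_self hr.le)
    rw [hx, sub_self, zero_mul, sub_zero, zero_mul, norm_zero, mul_zero, norm_le_zero_iff] at this
    exact mul_self_eq_zero.1 this
  obtain ⟨k, hk⟩ := exists_deriv_eq_of_omits hFd
    (exists_norm_deriv_le_of_loglogDeriv_le hF2) hFb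
  have hk0 : k ≠ 0 := by
    rintro rfl
    exact hF0' (by simpa using hk 0)
  obtain ⟨z, hz⟩ := exists_eq_of_deriv_eq hFd hk0 hk (hFb 0) hab
  have := hFa z hz
  rw [hk, hz] at this
  exact mul_ne_zero hk0 (sub_ne_zero.2 hab) this

lemma exists_norm_deriv_le_mul_one_add {f : ℂ → ℂ} (hf : Differentiable ℂ f)
    (hbd : ∀ K : ℝ, ∃ C, ∀ z, ‖f z‖ ≤ K → ‖deriv f z‖ ≤ C) :
    ∃ C, 0 ≤ C ∧ ∀ z, ‖deriv f z‖ ≤ C * (1 + ‖f z‖) := by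
  obtain ⟨C, hC⟩ := hbd 1
  refine ⟨4 * |C|, by positivity, fun z => ?_⟩
  have hC0 := abs_nonneg C
  rcases le_or_gt ‖f z‖ 1 with h | h
  · have := (hC z h).trans (le_abs_self C)
    nlinarith [norm_nonneg (f z), mul_nonneg hC0 (norm_nonneg (f z))]
  · have := norm_deriv_le_of_level_one hf hC0
      (fun w hw => (hC w hw.le).trans (le_abs_self C)) h
    linarith

lemma one_add_norm_le_of_norm_deriv_le {f : ℂ → ℂ} (hf : Differentiable ℂ f) {C : ℝ}
    (hC : ∀ z, ‖deriv f z‖ ≤ C * (1 + ‖f z‖)) (z w : ℂ) :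
    1 + ‖f w‖ ≤ (1 + ‖f z‖) * Real.exp (C * ‖w - z‖) := by
  have hd : ∀ t : ℝ, HasDerivAt (fun t : ℝ => f (z + (t : ℂ) * (w - z)))
      (deriv f (z + (t : ℂ) * (w - z)) * (w - z)) t := fun t => by
    have h2 : HasDerivAt (fun t : ℝ => z + (t : ℂ) * (w - z)) (w - z) t := by
      simpa using ((Complex.ofRealCLM.hasDerivAt (x := t)).mul_const (w - z)).const_add z
    exact (hf _).hasDerivAt.comp_of_eq t h2 rfl
  have := norm_le_gronwallBound_of_norm_deriv_right_le (a := 0) (b := 1) (δ := ‖f z‖)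
    (K := C * ‖w - z‖) (ε := C * ‖w - z‖)
    (fun t _ => (hd t).continuousAt.continuousWithinAt)
    (fun t _ => (hd t).hasDerivWithinAt) (by simp) (fun t _ => by
      rw [norm_mul]
      calc _ ≤ C * (1 + ‖f (z + (t : ℂ) * (w - z))‖) * ‖w - z‖ := by gcongr; exact hC _
        _ = _ := by ring) 1 (by simp)
  simp only [ofReal_one, one_mul, add_sub_cancel, sub_zero] at this
  rcases eq_or_ne (C * ‖w - z‖) 0 with h | h
  · rw [h, gronwallBound_K0] at this
    rw [h]
    simpa using this
  · rw [gronwallBound_of_K_ne_0 h, div_self h] at this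
    simp only [mul_one, one_mul] at this
    linarith

/-- Bounded values of `f` stay bounded on discs of radius `r`. -/
lemma exists_norm_le_on_closedBall {f : ℂ → ℂ} (hf : Differentiable ℂ f)
    (hbd : ∀ K : ℝ, ∃ C, ∀ z, ‖f z‖ ≤ K → ‖deriv f z‖ ≤ C) (r K : ℝ) :
    ∃ M, ∀ z, ‖f z‖ ≤ K → ∀ w ∈ closedBall z r, ‖f w‖ ≤ M := by
  obtain ⟨C, hC0, hC⟩ := exists_norm_deriv_le_mul_one_add hf hbd
  refine ⟨(1 + K) * Real.exp (C * r), fun z hz w hw => ?_⟩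
  have h1 := one_add_norm_le_of_norm_deriv_le hf hC z w
  have h2 : ‖w - z‖ ≤ r := by simpa [dist_eq_norm] using hw
  have h3 : (1 + ‖f z‖) * Real.exp (C * ‖w - z‖) ≤ (1 + K) * Real.exp (C * r) := by
    have := norm_nonneg (f z)
    have hK : 0 ≤ 1 + K := by linarith
    gcongr
  linarith

lemma hasDerivAt_const_div_sub {f : ℂ → ℂ} {w : ℂ} (hf : DifferentiableAt ℂ f w) (c s : ℂ)
    (hw : f w ≠ s) :
    HasDerivAt (fun ζ => c / (f ζ - s)) (-(c * deriv f w) / (f w - s) ^ 2) w := by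
  have h := (hasDerivAt_const w c).div (hf.hasDerivAt.sub_const s) (sub_ne_zero.2 hw)
  exact h.congr_deriv (by ring)

/-- Near a nonzero shared value `s`, either the logarithmic derivative of `f - s` is bounded,
or the point lies in a disc on whose boundary `‖f - s‖` is pinched. -/
lemma norm_deriv_le_or_exists_sphere {f : ℂ → ℂ} (hf : Differentiable ℂ f)
    (hnc : ¬ ∃ c, ∀ z, f z = c) (hbd : ∀ K : ℝ, ∃ C, ∀ z, ‖f z‖ ≤ K → ‖deriv f z‖ ≤ C)
    {s : ℂ} (hs : s ≠ 0) (hsf : ∀ z, f z = s → deriv f z = s) {δ : ℝ} (hδ : 0 < δ) :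
    ∃ c, 0 < c ∧ c ≤ δ ∧ ∃ M, ∀ z, ‖f z - s‖ < c → ‖deriv f z‖ ≤ M * ‖f z - s‖ ∨
      ∃ z₀ r, 0 < r ∧ z ∈ closedBall z₀ r ∧
        ∀ w ∈ sphere z₀ r, c ≤ ‖f w - s‖ ∧ ‖f w - s‖ ≤ δ := by
  have hs0 : 0 < ‖s‖ := norm_pos_iff.2 hs
  obtain ⟨M₀, hM₀⟩ := exists_norm_le_on_closedBall hf hbd 2 ‖s‖
  set B := (|M₀| + ‖s‖) / 2 with hB
  have hB0 : 0 < B := by positivity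
  set r := min 1 (min (‖s‖ / (2 * B)) (δ / (2 * ‖s‖))) with hr
  have hr0 : 0 < r := by positivity
  have hr1 : r ≤ 1 := min_le_left _ _
  have hrB : B * r ≤ ‖s‖ / 2 := by
    have h : r ≤ ‖s‖ / (2 * B) := (min_le_right _ _).trans (min_le_left _ _)
    rw [le_div_iff₀ (by positivity)] at h
    linarith
  have hrδ : 2 * ‖s‖ * r ≤ δ := by
    have h : r ≤ δ / (2 * ‖s‖) := (min_le_right _ _).trans (min_le_right _ _)
    rw [le_div_iff₀ (by positivity)] at h
    linarith
  set c := ‖s‖ / 2 * r with hc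
  have hc0 : 0 < c := by positivity
  have hcδ : c ≤ δ := by nlinarith
  have hsph : ∀ z₀, f z₀ = s → ∀ w ∈ sphere z₀ r, c ≤ ‖f w - s‖ ∧ ‖f w - s‖ ≤ δ := by
    intro z₀ hz₀ w hw
    have hwr : ‖w - z₀‖ = r := by simpa [dist_eq_norm] using hw
    set h := dslope f z₀ with hh
    have hhd : Differentiable ℂ h := differentiable_dslope hf z₀
    have hfw : ∀ w, f w - s = h w * (w - z₀) := fun w => by
      rw [dslope_mul_eq f z₀ w, hz₀]; ring
    have hh0 : h z₀ = s := by rw [hh, dslope_same, hsf z₀ hz₀]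
    have hhB : ∀ v ∈ closedBall z₀ 2, ‖h v‖ ≤ B := fun v hv => by
      refine Complex.norm_le_of_forall_mem_frontier_norm_le (U := ball z₀ 2) isBounded_ball
        hhd.diffContOnCl (fun u hu => ?_) (by rwa [closure_ball z₀ two_ne_zero])
      rw [frontier_ball z₀ two_ne_zero] at hu
      have hu2 : ‖u - z₀‖ = 2 := by simpa [dist_eq_norm] using hu
      have h1 : ‖h u‖ * 2 = ‖f u - s‖ := by rw [hfw, norm_mul, hu2]
      have h2 := norm_sub_le (f u) s
      have h3 := (hM₀ z₀ (by rw [hz₀]) u (sphere_subset_closedBall hu)).trans (le_abs_self _)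
      rw [hB]; linarith
    have hLip : ‖h w - h z₀‖ ≤ B * ‖w - z₀‖ := by
      refine (convex_closedBall z₀ 1).norm_image_sub_le_of_norm_deriv_le (𝕜 := ℂ)
        (fun w _ => hhd w) (fun v hv => ?_) (mem_closedBall_self zero_le_one)
        (by rw [mem_closedBall, dist_eq_norm, hwr]; exact hr1)
      have := Complex.norm_deriv_le_of_forall_mem_sphere_norm_le (c := v) (C := B) one_pos
        hhd.diffContOnCl (fun u hu => hhB u ?_)
      · simpa using this
      · rw [mem_sphere] at hu
        rw [mem_closedBall] at hv ⊢
        linarith [dist_triangle u v z₀]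
    rw [hh0, hwr] at hLip
    rw [hfw, norm_mul, hwr]
    have h1 := norm_sub_norm_le s (h w)
    rw [norm_sub_rev] at h1
    have h2 := norm_sub_norm_le (h w) s
    constructor
    · rw [hc]; gcongr; linarith
    · refine le_trans ?_ hrδ
      gcongr; linarith
  obtain ⟨C, hC⟩ := hbd (‖s‖ + c)
  refine ⟨c, hc0, hcδ, 4 * (C / c), fun z hz => ?_⟩
  set S := {w | c ≤ ‖f w - s‖} with hS
  have hfc := hf.continuous
  have hScl : IsClosed S := isClosed_le continuous_const (by fun_prop)
  have hSne : S.Nonempty := by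
    by_contra hemp
    rw [not_nonempty_iff_eq_empty] at hemp
    obtain ⟨k, hk⟩ := hf.exists_const_forall_eq_of_bounded
      ((isBounded_ball (x := s) (r := c)).subset (by
        rintro _ ⟨w, rfl⟩
        rw [mem_ball, dist_eq_norm]
        by_contra! h
        have : w ∈ S := h
        simp [hemp] at this))
    exact hnc ⟨k, hk⟩
  obtain ⟨w, hwS, hwd⟩ := hScl.exists_infDist_eq_dist hSne z
  set d := dist w z with hd
  rw [dist_comm] at hwd
  have hball : ∀ v ∈ ball z d, ‖f v - s‖ < c := fun v hv => by
    by_contra! h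
    have h1 := infDist_le_dist_of_mem (x := z) (show v ∈ S from h)
    rw [hwd, dist_comm z v] at h1
    exact absurd (mem_ball.1 hv) (not_lt.2 h1)
  have hd0 : 0 < d := by
    refine dist_pos.2 ?_
    rintro rfl
    exact absurd hz (not_lt.2 hwS)
  by_cases hex : ∃ z₀ ∈ ball z d, f z₀ = s
  · right
    obtain ⟨z₀, hz₀, hfz₀⟩ := hex
    refine ⟨z₀, r, hr0, ?_, hsph z₀ hfz₀⟩
    by_contra hfar
    rw [mem_closedBall, not_le] at hfar
    rw [mem_ball, dist_comm] at hz₀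
    have hD : 0 < dist z z₀ := hr0.trans hfar
    have hDn : ‖z - z₀‖ = dist z z₀ := (dist_eq_norm _ _).symm
    set v : ℂ := z₀ + ((r / dist z z₀ : ℝ) : ℂ) * (z - z₀) with hv
    have h1 : v ∈ sphere z₀ r := by
      rw [mem_sphere, dist_eq_norm, hv, add_sub_cancel_left, norm_mul, Complex.norm_real,
        Real.norm_of_nonneg (by positivity), hDn]
      field_simp
    have h2 : dist v z = dist z z₀ - r := by
      have : v - z = ((r / dist z z₀ - 1 : ℝ) : ℂ) * (z - z₀) := by
        rw [hv]; push_cast; ring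
      rw [dist_eq_norm, this, norm_mul, Complex.norm_real, hDn, Real.norm_of_nonpos]
      · field_simp; ring
      · rw [sub_nonpos, div_le_one hD]; exact hfar.le
    exact absurd (hball v (by rw [mem_ball]; linarith)) (not_lt.2 (hsph z₀ hfz₀ v h1).1)
  · left
    push Not at hex
    have hfw : ‖f w - s‖ = c := by
      refine le_antisymm ?_ hwS
      have hwcl : w ∈ closure (ball z d) := by
        rw [closure_ball z hd0.ne', mem_closedBall]
      have hsub : closure (ball z d) ⊆ {v | ‖f v - s‖ ≤ c} :=
        closure_minimal (fun v hv => (hball v hv).le) (isClosed_le (by fun_prop) continuous_const)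
      exact hsub hwcl
    have hws : f w ≠ s := fun h => by rw [h, sub_self, norm_zero] at hfw; linarith
    have hzs : f z ≠ s := hex z (mem_ball_self hd0)
    have hzp : 0 < ‖f z - s‖ := norm_pos_iff.2 (sub_ne_zero.2 hzs)
    have hmain := norm_deriv_le_of_boundary (G := fun ζ => (c : ℂ) / (f ζ - s)) hd0
      (fun v hv => (hasDerivAt_const_div_sub (hf v) c s
        (hex v hv)).differentiableAt.differentiableWithinAt)
      (fun v hv => by
        have := norm_pos_iff.2 (sub_ne_zero.2 (hex v hv))
        rw [norm_div, Complex.norm_real, Real.norm_of_nonneg hc0.le, one_lt_div this]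
        exact hball v hv) (w := w) rfl
      (by rw [norm_div, Complex.norm_real, Real.norm_of_nonneg hc0.le, hfw, div_self hc0.ne'])
      (hasDerivAt_const_div_sub (hf w) c s hws).differentiableAt
    rw [(hasDerivAt_const_div_sub (hf w) c s hws).deriv,
      (hasDerivAt_const_div_sub (hf z) c s hzs).deriv]
      at hmain
    simp only [norm_div, norm_neg, norm_mul, norm_pow, Complex.norm_real,
      Real.norm_of_nonneg hc0.le, hfw] at hmain
    have hCw : ‖deriv f w‖ ≤ C := hC w (by
      have := norm_sub_norm_le (f w) s
      linarith)
    rw [div_le_iff₀ (by positivity)] at hmain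
    have h3 : 4 * (c * ‖deriv f w‖ / c ^ 2) * (c / ‖f z - s‖) * ‖f z - s‖ ^ 2 =
        c * (4 * (‖deriv f w‖ / c) * ‖f z - s‖) := by field_simp
    rw [h3] at hmain
    refine (le_of_mul_le_mul_left hmain hc0).trans ?_
    gcongr

lemma norm_deriv_sq_le_of_ne_zero {k : ℂ → ℂ} (hk : Differentiable ℂ k) {z : ℂ} {d M : ℝ}
    (hd : 0 < d) (hM : 0 < M) (hkM : ∀ w ∈ ball z d, ‖k w‖ ≤ M)
    (hk0 : ∀ w ∈ ball z d, k w ≠ 0) : ‖deriv k z‖ ^ 2 * d ^ 2 ≤ 32 * M * ‖k z‖ := by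
  have hz : k z ≠ 0 := hk0 z (mem_ball_self hd)
  have hzp : 0 < ‖k z‖ := norm_pos_iff.2 hz
  have hM2 : ‖((2 * M : ℝ) : ℂ)‖ = 2 * M := by
    rw [Complex.norm_real, Real.norm_of_nonneg (by positivity)]
  have h1 := (norm_deriv_le_of_one_lt_norm (G := fun ζ => ((2 * M : ℝ) : ℂ) / (k ζ - 0)) hd
    (fun v hv => (hasDerivAt_const_div_sub (hk v) _ 0
      (hk0 v hv)).differentiableAt.differentiableWithinAt)
    (fun v hv => by
      have := norm_pos_iff.2 (hk0 v hv)
      rw [sub_zero, norm_div, hM2, one_lt_div this]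
      linarith [hkM v hv])).1
  rw [(hasDerivAt_const_div_sub (hk z) _ 0 hz).deriv] at h1
  simp only [norm_div, norm_neg, norm_mul, norm_pow, hM2, sub_zero] at h1
  set x := 2 * M / ‖k z‖ with hx
  have hx0 : 0 < x := by positivity
  have hxk : x * ‖k z‖ = 2 * M := by rw [hx]; field_simp
  have hx1 : 1 ≤ x := by
    rw [hx, one_le_div hzp]; linarith [hkM z (mem_ball_self hd)]
  have hlog : Real.log x ^ 2 ≤ 4 * x := by
    have h2 : Real.log x = 2 * Real.log (Real.sqrt x) := by rw [Real.log_sqrt hx0.le]; ring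
    have h3 := Real.log_le_self (Real.sqrt_nonneg x)
    have h4 : 0 ≤ Real.log x := Real.log_nonneg hx1
    have h5 := Real.sq_sqrt hx0.le
    nlinarith [Real.sqrt_nonneg x]
  rw [div_le_iff₀ (by positivity)] at h1
  have h2 : ‖deriv k z‖ * d ≤ 2 * Real.log x * ‖k z‖ := by
    have h3 : 2 * Real.log x / d * x * ‖k z‖ ^ 2 = 2 * M * (2 * Real.log x * ‖k z‖ / d) := by
      rw [← hxk]; ring
    rw [h3] at h1
    have := le_of_mul_le_mul_left h1 (by positivity)
    rwa [le_div_iff₀ hd] at this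
  calc ‖deriv k z‖ ^ 2 * d ^ 2 = (‖deriv k z‖ * d) ^ 2 := by ring
    _ ≤ (2 * Real.log x * ‖k z‖) ^ 2 := by gcongr
    _ = 4 * Real.log x ^ 2 * ‖k z‖ ^ 2 := by ring
    _ ≤ 4 * (4 * x) * ‖k z‖ ^ 2 := by gcongr
    _ = 16 * (x * ‖k z‖) * ‖k z‖ := by ring
    _ = _ := by rw [hxk]; ring

/-- If every zero of `f` is multiple, then `‖f'‖² = O(‖f‖)` where `f` is small. -/
lemma exists_norm_deriv_sq_le {f : ℂ → ℂ} (hf : Differentiable ℂ f)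
    (hbd : ∀ K : ℝ, ∃ C, ∀ z, ‖f z‖ ≤ K → ‖deriv f z‖ ≤ C)
    (h0 : ∀ z, f z = 0 → deriv f z = 0) :
    ∃ M, 0 ≤ M ∧ ∀ z, ‖f z‖ ≤ 1 → ‖deriv f z‖ ^ 2 ≤ M * ‖f z‖ := by
  obtain ⟨M₁, hM₁⟩ := exists_norm_le_on_closedBall hf hbd 2 1
  set M := |M₁| + 1 with hMdef
  have hM0 : 0 < M := by positivity
  have hM : ∀ z, ‖f z‖ ≤ 1 → ∀ w ∈ closedBall z 2, ‖f w‖ ≤ M := fun z hz w hw =>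
    (hM₁ z hz w hw).trans (by rw [hMdef]; linarith [le_abs_self M₁])
  refine ⟨128 * M, by positivity, fun z hz => ?_⟩
  by_cases hex : ∃ z₁ ∈ ball z (1 / 2), f z₁ = 0
  · by_cases hfz : f z = 0
    · rw [h0 z hfz, hfz]; simp
    obtain ⟨z₁, hz₁, hfz₁⟩ := hex
    have hfc := hf.continuous
    have hZcl : IsClosed {w | f w = 0} := isClosed_eq hfc continuous_const
    obtain ⟨z₀, hz₀, hdist⟩ := hZcl.exists_infDist_eq_dist ⟨z₁, hfz₁⟩ z
    have hfz₀ : f z₀ = 0 := hz₀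
    set d := dist z z₀ with hd
    have hd0 : 0 < d := dist_pos.2 (by rintro rfl; exact hfz hfz₀)
    have hd2 : d < 1 / 2 := by
      rw [← hdist]
      refine (infDist_le_dist_of_mem (show z₁ ∈ {w | f w = 0} from hfz₁)).trans_lt ?_
      rw [dist_comm]; exact hz₁
    set k := dslope (dslope f z₀) z₀ with hk
    have hkd : Differentiable ℂ k := differentiable_dslope (differentiable_dslope hf z₀) z₀
    have hfk : ∀ w, f w = (w - z₀) ^ 2 * k w := fun w => by
      rw [dslope_mul_eq f z₀ w, dslope_mul_eq (dslope f z₀) z₀ w, dslope_same, hfz₀,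
        h0 z₀ hfz₀]
      ring
    have hkM : ∀ v ∈ closedBall z₀ 1, ‖k v‖ ≤ M := fun v hv => by
      refine Complex.norm_le_of_forall_mem_frontier_norm_le (U := ball z₀ 1) isBounded_ball
        hkd.diffContOnCl (fun u hu => ?_) (by rwa [closure_ball z₀ one_ne_zero])
      rw [frontier_ball z₀ one_ne_zero] at hu
      have hu1 : ‖u - z₀‖ = 1 := by simpa [dist_eq_norm] using hu
      have h1 := hM z hz u (by
        rw [mem_sphere] at hu
        rw [mem_closedBall]
        linarith [dist_triangle u z₀ z, dist_comm z z₀])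
      rwa [hfk, norm_mul, norm_pow, hu1, one_pow, one_mul] at h1
    have hmain := norm_deriv_sq_le_of_ne_zero hkd hd0 hM0 (z := z)
      (fun w hw => hkM w (by
        rw [mem_ball] at hw
        rw [mem_closedBall]
        linarith [dist_triangle w z z₀]))
      (fun w hw hkw => by
        have h1 : f w = 0 := by rw [hfk, hkw, mul_zero]
        have h2 := infDist_le_dist_of_mem (x := z) (show w ∈ {w | f w = 0} from h1)
        rw [hdist, dist_comm] at h2
        exact absurd (mem_ball.1 hw) (not_lt.2 h2))
    have hkz : ‖k z‖ ≤ M := hkM z (by rw [mem_closedBall]; linarith)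
    have hdz : ‖z - z₀‖ = d := (dist_eq_norm _ _).symm
    have hfz' : ‖f z‖ = d ^ 2 * ‖k z‖ := by rw [hfk, norm_mul, norm_pow, hdz]
    have hder : deriv f z = 2 * (z - z₀) * k z + (z - z₀) ^ 2 * deriv k z := by
      have h1 : HasDerivAt (fun w => (w - z₀) ^ 2 * k w)
          (2 * (z - z₀) * k z + (z - z₀) ^ 2 * deriv k z) z := by
        have := (((hasDerivAt_id z).sub_const z₀).pow 2).mul (hkd z).hasDerivAt
        refine this.congr_deriv ?_
        simp
      rw [show f = fun w => (w - z₀) ^ 2 * k w from funext hfk]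
      exact h1.deriv
    have hnd : ‖deriv f z‖ ≤ 2 * d * ‖k z‖ + d ^ 2 * ‖deriv k z‖ := by
      rw [hder]
      refine (norm_add_le _ _).trans ?_
      rw [norm_mul, norm_mul, norm_mul, norm_pow, hdz]
      simp
    have hknn := norm_nonneg (k z)
    have hsq : ‖deriv f z‖ ^ 2 ≤ (2 * d * ‖k z‖ + d ^ 2 * ‖deriv k z‖) ^ 2 := by gcongr
    have hd2p : 0 ≤ d ^ 2 := by positivity
    have e1 : (2 * d * ‖k z‖ + d ^ 2 * ‖deriv k z‖) ^ 2 ≤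
        8 * d ^ 2 * ‖k z‖ * ‖k z‖ + 2 * d ^ 2 * (‖deriv k z‖ ^ 2 * d ^ 2) := by
      nlinarith [sq_nonneg (2 * d * ‖k z‖ - d ^ 2 * ‖deriv k z‖)]
    have e2 : 8 * d ^ 2 * ‖k z‖ * ‖k z‖ ≤ 8 * d ^ 2 * ‖k z‖ * M := by gcongr
    have e3 : 2 * d ^ 2 * (‖deriv k z‖ ^ 2 * d ^ 2) ≤ 2 * d ^ 2 * (32 * M * ‖k z‖) := by gcongr
    rw [hfz']
    nlinarith [mul_nonneg (mul_nonneg hd2p hknn) hM0.le]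
  · push Not at hex
    have := norm_deriv_sq_le_of_ne_zero hf (by norm_num : (0 : ℝ) < 1 / 2) hM0
      (fun w hw => hM z hz w (by
        rw [mem_ball] at hw
        rw [mem_closedBall]
        linarith)) hex
    linarith

lemma exists_quotient_norm_le_of_le {f q : ℂ → ℂ} {C : ℝ} (hC0 : 0 ≤ C)
    (hC : ∀ z, ‖deriv f z‖ ≤ C * (1 + ‖f z‖)) {s t : ℂ}
    (hq : ∀ z, deriv f z * (deriv f z - f z) = q z * ((f z - s) * (f z - t))) {c : ℝ}
    (hc : 0 < c) : ∃ M, ∀ z, c ≤ ‖f z - s‖ → c ≤ ‖f z - t‖ → ‖q z‖ ≤ M := by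
  have hlin : ∀ s w : ℂ, c ≤ ‖w - s‖ → 1 + ‖w‖ ≤ (1 + (1 + ‖s‖) / c) * ‖w - s‖ := by
    intro s w h
    have h1 := norm_sub_norm_le w s
    have h2 : 1 + ‖s‖ ≤ (1 + ‖s‖) / c * ‖w - s‖ := by
      rw [div_mul_eq_mul_div, le_div_iff₀ hc]
      gcongr
    linarith
  refine ⟨C * (1 + (1 + ‖s‖) / c) * ((C + 1) * (1 + (1 + ‖t‖) / c)), fun z hs ht => ?_⟩
  have hs0 : 0 < ‖f z - s‖ := hc.trans_le hs
  have ht0 : 0 < ‖f z - t‖ := hc.trans_le ht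
  have h1 : ‖deriv f z‖ ≤ C * ((1 + (1 + ‖s‖) / c) * ‖f z - s‖) :=
    (hC z).trans (by gcongr; exact hlin s _ hs)
  have h2 : ‖deriv f z - f z‖ ≤ (C + 1) * ((1 + (1 + ‖t‖) / c) * ‖f z - t‖) := by
    refine le_trans ?_ (mul_le_mul_of_nonneg_left (hlin t _ ht) (by positivity))
    linarith [norm_sub_le (deriv f z) (f z), hC z]
  refine le_of_mul_le_mul_right ?_ (mul_pos hs0 ht0)
  calc ‖q z‖ * (‖f z - s‖ * ‖f z - t‖) = ‖deriv f z‖ * ‖deriv f z - f z‖ := by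
        rw [← norm_mul, ← norm_mul, ← norm_mul, hq]
    _ ≤ (C * ((1 + (1 + ‖s‖) / c) * ‖f z - s‖)) *
        ((C + 1) * ((1 + (1 + ‖t‖) / c) * ‖f z - t‖)) := by gcongr
    _ = _ := by ring

lemma exists_quotient_norm_le_near {f q : ℂ → ℂ} (hf : Differentiable ℂ f)
    (hnc : ¬ ∃ c, ∀ z, f z = c) (hbd : ∀ K : ℝ, ∃ C, ∀ z, ‖f z‖ ≤ K → ‖deriv f z‖ ≤ C)
    (hqd : Differentiable ℂ q) {s t : ℂ} (hst : s ≠ t) (hs : s ≠ 0)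
    (hsf : ∀ z, f z = s → deriv f z = s)
    (hq : ∀ z, deriv f z * (deriv f z - f z) = q z * ((f z - s) * (f z - t))) :
    ∃ c, 0 < c ∧ ∃ M, ∀ z, ‖f z - s‖ < c → ‖q z‖ ≤ M := by
  obtain ⟨C, hC0, hC⟩ := exists_norm_deriv_le_mul_one_add hf hbd
  set δ := ‖s - t‖ / 2 with hδ
  have hδ0 : 0 < δ := by
    have := norm_pos_iff.2 (sub_ne_zero.2 hst)
    positivity
  have hft : ∀ w, ‖w - s‖ ≤ δ → δ ≤ ‖w - t‖ := fun w hw => by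
    have : ‖s - t‖ ≤ ‖w - s‖ + ‖w - t‖ := by
      rw [norm_sub_rev w s]
      exact (norm_sub_le_norm_sub_add_norm_sub s w t)
    linarith
  obtain ⟨c, hc0, hcδ, M, hM⟩ := norm_deriv_le_or_exists_sphere hf hnc hbd hs hsf hδ0
  obtain ⟨M₁, hM₁⟩ := exists_quotient_norm_le_of_le hC0 hC hq hc0
  refine ⟨c, hc0, max (M * ((C + 1) * (1 + (‖s‖ + δ))) / δ) M₁, fun z hz => ?_⟩
  rcases hM z hz with h | ⟨z₀, r, hr, hzr, hsph⟩
  · refine le_trans ?_ (le_max_left _ _)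
    have hzs : f z ≠ s := fun h1 => by
      rw [hsf z h1, h1, sub_self, norm_zero, mul_zero, norm_le_zero_iff] at h
      exact hs h
    have hz0 : 0 < ‖f z - s‖ := norm_pos_iff.2 (sub_ne_zero.2 hzs)
    have hzt := hft (f z) (hz.le.trans hcδ)
    have hfz : ‖f z‖ ≤ ‖s‖ + δ := by linarith [norm_sub_norm_le (f z) s]
    have h2 : ‖deriv f z - f z‖ ≤ (C + 1) * (1 + (‖s‖ + δ)) := by
      have h3 : ‖deriv f z - f z‖ ≤ (C + 1) * (1 + ‖f z‖) := by
        linarith [norm_sub_le (deriv f z) (f z), hC z]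
      refine h3.trans ?_
      gcongr
    rw [le_div_iff₀ hδ0]
    refine le_of_mul_le_mul_right ?_ hz0
    calc ‖q z‖ * δ * ‖f z - s‖ ≤ ‖q z‖ * ‖f z - t‖ * ‖f z - s‖ := by gcongr
      _ = ‖deriv f z‖ * ‖deriv f z - f z‖ := by
        rw [← norm_mul, ← norm_mul, ← norm_mul, hq]; ring_nf
      _ ≤ (M * ‖f z - s‖) * ((C + 1) * (1 + (‖s‖ + δ))) := by
        have := (norm_nonneg _).trans h
        gcongr
      _ = _ := by ring
  · refine le_trans ?_ (le_max_right _ _)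
    refine Complex.norm_le_of_forall_mem_frontier_norm_le (U := ball z₀ r) isBounded_ball
        hqd.diffContOnCl (fun u hu => ?_) (by rwa [closure_ball z₀ hr.ne'])
    rw [frontier_ball z₀ hr.ne'] at hu
    obtain ⟨h1, h2⟩ := hsph u hu
    exact hM₁ u h1 (hcδ.trans (hft _ h2))

lemma exists_quotient_norm_le_near_zero {f q : ℂ → ℂ} (hf : Differentiable ℂ f)
    (hnc : ¬ ∃ c, ∀ z, f z = c) (hbd : ∀ K : ℝ, ∃ C, ∀ z, ‖f z‖ ≤ K → ‖deriv f z‖ ≤ C)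
    (hqd : Differentiable ℂ q) {b : ℂ} (hb : b ≠ 0) (h0 : ∀ z, f z = 0 → deriv f z = 0)
    (hq : ∀ z, deriv f z * (deriv f z - f z) = q z * ((f z - 0) * (f z - b))) :
    ∃ c, 0 < c ∧ ∃ M, ∀ z, ‖f z - 0‖ < c → ‖q z‖ ≤ M := by
  obtain ⟨C, hC⟩ := hbd 1
  obtain ⟨M, hM0, hM⟩ := exists_norm_deriv_sq_le hf hbd h0
  have hb0 : 0 < ‖b‖ := norm_pos_iff.2 hb
  have hgen : ∀ z, ‖f z‖ < min 1 (‖b‖ / 2) → f z ≠ 0 → ‖q z‖ ≤ (M + C) / (‖b‖ / 2) := by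
    intro z hz hz0
    have hz1 : ‖f z‖ ≤ 1 := hz.le.trans (min_le_left _ _)
    have hz2 : ‖f z‖ ≤ ‖b‖ / 2 := hz.le.trans (min_le_right _ _)
    have hzp : 0 < ‖f z‖ := norm_pos_iff.2 hz0
    have hzb : ‖b‖ / 2 ≤ ‖f z - b‖ := by
      have := norm_sub_norm_le b (f z)
      rw [norm_sub_rev] at this
      linarith
    rw [le_div_iff₀ (by positivity)]
    refine le_of_mul_le_mul_right ?_ hzp
    calc ‖q z‖ * (‖b‖ / 2) * ‖f z‖ ≤ ‖q z‖ * ‖f z - b‖ * ‖f z‖ := by gcongr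
      _ = ‖deriv f z‖ * ‖deriv f z - f z‖ := by
        rw [← norm_mul, ← norm_mul, ← norm_mul, hq]; ring_nf
      _ ≤ ‖deriv f z‖ * (‖deriv f z‖ + ‖f z‖) := by gcongr; exact norm_sub_le _ _
      _ = ‖deriv f z‖ ^ 2 + ‖deriv f z‖ * ‖f z‖ := by ring
      _ ≤ M * ‖f z‖ + C * ‖f z‖ := by
        gcongr
        · exact hM z hz1
        · exact hC z hz1
      _ = _ := by ring
  refine ⟨min 1 (‖b‖ / 2), by positivity, (M + C) / (‖b‖ / 2), fun z hz => ?_⟩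
  rw [sub_zero] at hz
  have hcont : Tendsto (fun w => ‖q w‖) (𝓝[≠] z) (𝓝 ‖q z‖) :=
    (hqd.continuous.norm.tendsto z).mono_left nhdsWithin_le_nhds
  refine le_of_tendsto hcont ?_
  filter_upwards [eventually_ne_of_nonconst hf hnc 0 z,
    nhdsWithin_le_nhds ((hf.continuous.norm.tendsto z).eventually_lt_const hz)] with w hw1 hw2
  exact hgen w hw2 hw1

/-- The quadratic first-order differential equation satisfied by `f`. -/
lemma exists_deriv_mul_deriv_sub_eq {a b : ℂ} (hab : a ≠ b) (hb : b ≠ 0) {f : ℂ → ℂ}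
    (hf : Differentiable ℂ f) (hnc : ¬ ∃ c, ∀ z, f z = c)
    (hbd : ∀ K : ℝ, ∃ C, ∀ z, ‖f z‖ ≤ K → ‖deriv f z‖ ≤ C)
    (hsa : ∀ z, f z = a → deriv f z = a) (hsb : ∀ z, f z = b → deriv f z = b) :
    ∃ k : ℂ, ∀ z, deriv f z * (deriv f z - f z) = k * ((f z - a) * (f z - b)) := by
  obtain ⟨q, hqd, hq⟩ := exists_product_quotient hab hb hf hnc hsa hsb
  have hA : ∃ c, 0 < c ∧ ∃ M, ∀ z, ‖f z - a‖ < c → ‖q z‖ ≤ M := by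
    rcases eq_or_ne a 0 with rfl | ha
    · exact exists_quotient_norm_le_near_zero hf hnc hbd hqd hb hsa hq
    · exact exists_quotient_norm_le_near hf hnc hbd hqd hab ha hsa hq
  obtain ⟨c₁, hc₁, M₁, hM₁⟩ := hA
  obtain ⟨c₂, hc₂, M₂, hM₂⟩ := exists_quotient_norm_le_near hf hnc hbd hqd hab.symm hb hsb
    (fun z => by rw [hq, mul_comm (f z - a)])
  obtain ⟨C, hC0, hC⟩ := exists_norm_deriv_le_mul_one_add hf hbd
  obtain ⟨M₃, hM₃⟩ := exists_quotient_norm_le_of_le hC0 hC hq (lt_min hc₁ hc₂)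
  obtain ⟨k, hk⟩ := hqd.exists_const_forall_eq_of_bounded (isBounded_iff_forall_norm_le.2
    ⟨max M₁ (max M₂ M₃), by
      rintro _ ⟨z, rfl⟩
      rcases lt_or_ge ‖f z - a‖ c₁ with h1 | h1
      · exact (hM₁ z h1).trans (le_max_left _ _)
      rcases lt_or_ge ‖f z - b‖ c₂ with h2 | h2
      · exact (hM₂ z h2).trans ((le_max_left _ _).trans (le_max_right _ _))
      · exact (hM₃ z ((min_le_left _ _).trans h1) ((min_le_right _ _).trans h2)).trans
          ((le_max_right _ _).trans (le_max_right _ _))⟩)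
  exact ⟨k, fun z => by rw [hq, hk]⟩

lemma entire_eq_zero_or_of_mul_eq_zero {g h : ℂ → ℂ} (hg : Differentiable ℂ g)
    (hh : Differentiable ℂ h) (H : ∀ z, g z * h z = 0) : (∀ z, g z = 0) ∨ ∀ z, h z = 0 := by
  rcases AnalyticOnNhd.eq_zero_or_eq_zero_of_mul_eq_zero (U := univ)
    (fun z _ => hg.analyticAt z) (fun z _ => hh.analyticAt z) (fun z _ => H z)
    isPreconnected_univ with h1 | h1
  · exact Or.inl fun z => h1 z (mem_univ z)
  · exact Or.inr fun z => h1 z (mem_univ z)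

lemma entire_eq_or_eq_neg_of_sq_eq {g h : ℂ → ℂ} (hg : Differentiable ℂ g)
    (hh : Differentiable ℂ h) (H : ∀ z, g z ^ 2 = h z ^ 2) :
    (∀ z, g z = h z) ∨ ∀ z, g z = -h z := by
  rcases entire_eq_zero_or_of_mul_eq_zero (hg.sub hh) (hg.add hh)
    (fun z => by simp only [Pi.sub_apply, Pi.add_apply]; linear_combination H z) with h1 | h1
  · exact Or.inl fun z => sub_eq_zero.1 (h1 z)
  · exact Or.inr fun z => eq_neg_of_add_eq_zero_left (h1 z)

/-- The classification when `f` satisfies a linear first-order equation. -/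
lemma classification_of_deriv_eq_linear {a b : ℂ} (hab : a ≠ b) (hb : b ≠ 0) {f : ℂ → ℂ}
    (hf : Differentiable ℂ f) (hnc : ¬ ∃ c, ∀ z, f z = c)
    (hsa : ∀ z, f z = a → deriv f z = a) (hsb : ∀ z, f z = b → deriv f z = b) {l m : ℂ}
    (hlin : ∀ z, deriv f z = l * f z + m) :
    (deriv f = f) ∨
    (a ≠ 0 ∧ ∃ A : ℂ, A ≠ 0 ∧ ∀ z : ℂ, f z = A * Complex.exp (b * z / (b - a)) + a) ∨
    (a ≠ 0 ∧ ∃ A : ℂ, A ≠ 0 ∧ ∀ z : ℂ, f z = A * Complex.exp (a * z / (a - b)) + b) := by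
  have hab' : a - b ≠ 0 := sub_ne_zero.2 hab
  have hba' : b - a ≠ 0 := sub_ne_zero.2 hab.symm
  rcases eq_or_ne l 0 with rfl | hl
  · exfalso
    have hm : m ≠ 0 := by
      rintro rfl
      exact hnc ⟨f 0, fun z => is_const_of_deriv_eq_zero hf (fun x => by simp [hlin]) z 0⟩
    have hd : ∀ x, HasDerivAt (fun z => f z - m * z) 0 x := fun x => by
      refine ((hf x).hasDerivAt.sub ((hasDerivAt_id x).const_mul m)).congr_deriv ?_
      rw [hlin]; ring
    have hfz : ∀ z, f z = m * z + f 0 := fun z => by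
      have := is_const_of_deriv_eq_zero (fun x => (hd x).differentiableAt)
        (fun x => (hd x).deriv) z 0
      simp only [mul_zero, sub_zero] at this
      linear_combination this
    have hatt : ∀ c, f ((c - f 0) / m) = c := fun c => by
      rw [hfz]; field_simp; ring
    have h1 := hsa _ (hatt a)
    have h2 := hsb _ (hatt b)
    rw [hlin] at h1 h2
    exact hab (by linear_combination h2 - h1)
  obtain ⟨w, hw⟩ : ∃ w, m = -(l * w) := ⟨-(m / l), by field_simp⟩
  have hlin' : ∀ z, deriv f z = l * (f z - w) := fun z => by rw [hlin, hw]; ring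
  have hfz := eq_add_exp_of_deriv_eq hf hlin'
  have h0 : f 0 ≠ w := fun h => hnc ⟨w, fun z => by rw [hfz z, h]; ring⟩
  have hA : f 0 - w ≠ 0 := sub_ne_zero.2 h0
  have hatt : ∀ c, c ≠ w → (∀ z, f z = c → deriv f z = c) → l * (c - w) = c := by
    intro c hc hsc
    obtain ⟨z, hz⟩ := exists_eq_of_deriv_eq hf hl hlin' h0 hc
    have := hsc z hz
    rwa [hlin', hz] at this
  rcases eq_or_ne a w with rfl | haw
  · have h1 := hatt b hab.symm hsb
    have hl' : l = b / (b - a) := by rw [eq_div_iff hba']; exact h1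
    rcases eq_or_ne a 0 with rfl | ha
    · left
      have hl1 : l = 1 := by rw [hl', sub_zero, div_self hb]
      funext z
      rw [hlin', hl1]; ring
    · refine Or.inr (Or.inl ⟨ha, f 0 - a, hA, fun z => ?_⟩)
      rw [hfz z, hl', div_mul_eq_mul_div]
  have h1 := hatt a haw hsa
  rcases eq_or_ne b w with rfl | hbw
  · have hl' : l = a / (a - b) := by rw [eq_div_iff hab']; exact h1
    have ha : a ≠ 0 := by
      rintro rfl
      rw [zero_div] at hl'
      exact hl hl'
    refine Or.inr (Or.inr ⟨ha, f 0 - b, hA, fun z => ?_⟩)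
    rw [hfz z, hl', div_mul_eq_mul_div]
  · left
    have h2 := hatt b hbw hsb
    have hl1 : l = 1 := mul_right_cancel₀ hab' (by linear_combination h1 - h2)
    have hw0 : w = 0 := by rw [hl1] at h1; linear_combination -h1
    funext z
    rw [hlin', hl1, hw0]; ring

/-- **Theorem B (Two Values Entire, Lü–Xu–Yi).** If a nonconstant entire function `f`
partially shares two distinct values `a` and `b ≠ 0` with its derivative, then either
`f' = f`, or `f = A e^{bz/(b-a)} + a` with `a ≠ 0`, or `f = A e^{az/(a-b)} + b` with
`a ≠ 0`, or `f = b (A/2 · e^{z/4} + 1)²` with `a = 0`, where `A` is a nonzero constant. -/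
theorem two_values_entire
    (a b : ℂ) (hab : a ≠ b) (hb : b ≠ 0)
    (f : ℂ → ℂ) (hf : Differentiable ℂ f)
    (hnonconst : ¬ ∃ c : ℂ, ∀ z : ℂ, f z = c)
    (hsa : ∀ z : ℂ, f z = a → deriv f z = a)
    (hsb : ∀ z : ℂ, f z = b → deriv f z = b) :
    (deriv f = f) ∨
    (a ≠ 0 ∧ ∃ A : ℂ, A ≠ 0 ∧ ∀ z : ℂ, f z = A * Complex.exp (b * z / (b - a)) + a) ∨
    (a ≠ 0 ∧ ∃ A : ℂ, A ≠ 0 ∧ ∀ z : ℂ, f z = A * Complex.exp (a * z / (a - b)) + b) ∨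
    (a = 0 ∧ ∃ A : ℂ, A ≠ 0 ∧ ∀ z : ℂ, f z = b * (A / 2 * Complex.exp (z / 4) + 1) ^ 2) := by
  have hbd := exists_norm_deriv_le_on_sublevel hab hb hf hnonconst hsa hsb
  obtain ⟨k, hk⟩ := exists_deriv_mul_deriv_sub_eq hab hb hf hnonconst hbd hsa hsb
  have hlinear : ∀ l m : ℂ, (∀ z, deriv f z = l * f z + m) → _ := fun l m h =>
    (classification_of_deriv_eq_linear hab hb hf hnonconst hsa hsb h).imp_right
      fun h => h.imp_right (Or.inl (b := a = 0 ∧ ∃ A : ℂ, A ≠ 0 ∧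
        ∀ z : ℂ, f z = b * (A / 2 * Complex.exp (z / 4) + 1) ^ 2))
  by_cases homit : ∃ w, ∀ z, f z ≠ w
  · obtain ⟨w, hw⟩ := homit
    obtain ⟨l, hl⟩ := exists_deriv_eq_of_omits hf hbd hw
    exact hlinear l (-(l * w)) fun z => by rw [hl]; ring
  push Not at homit
  rcases eq_or_ne k 0 with rfl | hk0
  · rcases entire_eq_zero_or_of_mul_eq_zero hf.deriv (hf.deriv.sub hf)
      (fun z => by rw [Pi.sub_apply, hk, zero_mul]) with h | h
    · exact hlinear 0 0 fun z => by rw [h]; ring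
    · exact hlinear 1 0 fun z => by rw [sub_eq_zero.1 (h z)]; ring
  have h4k : 4 * k ≠ 0 := mul_ne_zero (by norm_num) hk0
  have hgd : Differentiable ℂ (fun z => 2 * deriv f z - f z) := (hf.deriv.const_mul 2).sub hf
  have hgsq : ∀ z, (2 * deriv f z - f z) ^ 2 =
      (1 + 4 * k) * f z ^ 2 - 4 * k * (a + b) * f z + 4 * k * (a * b) := fun z => by
    linear_combination 4 * hk z
  have hgd' : ∀ z, 2 * (2 * deriv f z - f z) * deriv (fun z => 2 * deriv f z - f z) z =
      (2 * (1 + 4 * k) * f z - 4 * k * (a + b)) * deriv f z := fun z => by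
    have h1 := (hgd z).hasDerivAt.pow 2
    have h2 := ((((hf z).hasDerivAt.pow 2).const_mul (1 + 4 * k)).sub
      ((hf z).hasDerivAt.const_mul (4 * k * (a + b)))).add_const (4 * k * (a * b))
    have h3 := h1.unique (h2.congr_of_eventuallyEq (Eventually.of_forall hgsq))
    simp only [Nat.cast_ofNat, Nat.add_one_sub_one, pow_one] at h3
    linear_combination h3
  -- an attained nonzero root of the quadratic is a double root
  have hdouble : ∀ w : ℂ, w ≠ 0 →
      (1 + 4 * k) * w ^ 2 - 4 * k * (a + b) * w + 4 * k * (a * b) = 0 →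
      2 * (1 + 4 * k) * w - 4 * k * (a + b) = 0 := by
    intro w hw0 hw
    obtain ⟨z, rfl⟩ := homit w
    have h1 := hgsq z
    rw [hw, sq_eq_zero_iff] at h1
    have h2 := hgd' z
    rw [h1, mul_zero, zero_mul, eq_comm, mul_eq_zero] at h2
    refine h2.resolve_right fun h3 => hw0 ?_
    rw [h3] at h1
    linear_combination -h1
  rcases eq_or_ne a 0 with rfl | ha
  · rcases eq_or_ne (1 + 4 * k) 0 with hk1 | hk1
    · have hk4 : 4 * k = -1 := by linear_combination hk1
      have hgf : ∀ z, (2 * deriv f z - f z) ^ 2 = b * f z := fun z => by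
        rw [hgsq, hk1, hk4]; ring
      rcases entire_eq_zero_or_of_mul_eq_zero hgd
        (((hgd.deriv.const_mul 4).sub hgd).sub_const b) (fun z => by
          have h1 := hgd' z
          rw [hk1, hk4] at h1
          simp only [Pi.sub_apply]
          linear_combination 2 * h1 - hgf z) with h | h
      · exact absurd ⟨0, fun z => by
          have := hgf z
          rw [h, zero_pow two_ne_zero, eq_comm, mul_eq_zero] at this
          exact this.resolve_left hb⟩ hnonconst
      · have hg := eq_add_exp_of_deriv_eq hgd (k := 1 / 4) (w := -b) (fun z => by
          have := h z
          simp only [Pi.sub_apply] at this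
          linear_combination this / 4)
        set B := 2 * deriv f 0 - f 0 - -b with hB
        have hfz : ∀ z, f z = b * (-(2 * B / b) / 2 * Complex.exp (z / 4) + 1) ^ 2 := fun z => by
          have h1 := hgf z
          rw [hg z, one_div_mul_eq_div] at h1
          field_simp
          linear_combination -h1
        refine Or.inr (Or.inr (Or.inr ⟨rfl, -(2 * B / b), fun h0 => hnonconst ⟨b, fun z => ?_⟩,
          hfz⟩))
        rw [hfz, h0]; ring
    · have hw : 4 * k * b / (1 + 4 * k) ≠ 0 :=
        div_ne_zero (mul_ne_zero h4k hb) hk1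
      have h1 := hdouble _ hw (by field_simp; ring)
      exfalso
      apply mul_ne_zero h4k hb
      field_simp at h1
      linear_combination h1
  · rcases eq_or_ne (1 + 4 * k) 0 with hk1 | hk1
    · have hk4 : 4 * k = -1 := by linear_combination hk1
      rcases eq_or_ne (a + b) 0 with hs | hs
      · rcases entire_eq_or_eq_neg_of_sq_eq hgd (differentiable_const b) (fun z => by
          rw [hgsq, hk1, hk4, hs]; linear_combination -b * hs) with h | h
        · exact hlinear (1 / 2) (b / 2) fun z => by linear_combination h z / 2
        · exact hlinear (1 / 2) (-b / 2) fun z => by linear_combination h z / 2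
      · have h1 := hdouble (a * b / (a + b)) (div_ne_zero (mul_ne_zero ha hb) hs) (by
          rw [hk1, hk4]; field_simp; ring)
        rw [hk1, hk4] at h1
        exact absurd (by linear_combination h1) hs
    · obtain ⟨s, hs⟩ := IsAlgClosed.exists_pow_nat_eq (1 + 4 * k) two_pos
      obtain ⟨e, he⟩ := IsAlgClosed.exists_pow_nat_eq
        ((2 * k * (a + b)) ^ 2 - (1 + 4 * k) * (4 * k * (a * b))) two_pos
      obtain ⟨w, hw⟩ : ∃ w, (1 + 4 * k) * w = 2 * k * (a + b) + e :=
        ⟨(2 * k * (a + b) + e) / (1 + 4 * k), by field_simp⟩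
      have hroot : (1 + 4 * k) * w ^ 2 - 4 * k * (a + b) * w + 4 * k * (a * b) = 0 := by
        refine mul_left_cancel₀ hk1 ?_
        linear_combination ((1 + 4 * k) * w - 2 * k * (a + b) + e) * hw + he
      have hw0 : w ≠ 0 := by
        rintro rfl
        apply mul_ne_zero h4k (mul_ne_zero ha hb)
        linear_combination hroot
      have hd := hdouble w hw0 hroot
      rcases entire_eq_or_eq_neg_of_sq_eq hgd ((hf.sub_const w).const_mul s) (fun z => by
        rw [hgsq, mul_pow, hs]
        linear_combination hroot + (f z - w) * hd) with h | h
      · exact hlinear ((1 + s) / 2) (-(s * w) / 2) fun z => by linear_combination h z / 2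
      · exact hlinear ((1 - s) / 2) (s * w / 2) fun z => by linear_combination h z / 2
end

section
/- There is no nonconstant rational function that partially shares four pairwise distinct finite values with its derivative. Precisely: let P, Q be coprime polynomials over ℂ with Q ≠ 0 and P/Q nonconstant, let f(z) = P(z)/Q(z) (defined for z with Q(z) ≠ 0), and let a₁, a₂, a₃, a₄ be pairwise distinct complex numbers. Then it cannot happen that for all k = 1,…,4 and all z ∈ ℂ with Q(z) ≠ 0, f(z) = aₖ implies f'(z) = aₖ. -/
open Polynomial

/-- Clearing denominators in `f - f'` for `f = P / Q` gives a nonzero polynomial. -/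
theorem self_sub_derivative_numerator_ne_zero {P Q : ℂ[X]} (hP : P ≠ 0) (hQ : Q ≠ 0) :
    P * Q - (derivative P * Q - P * derivative Q) ≠ 0 := by
  intro h
  have hPQ : P * Q ≠ 0 := mul_ne_zero hP hQ
  have hlt : (derivative P * Q - P * derivative Q).degree < (P * Q).degree := by
    refine (degree_sub_le _ _).trans_lt (max_lt ?_ ?_)
    · by_cases hd : derivative P = 0
      · simpa [hd, bot_lt_iff_ne_bot, degree_eq_bot] using hPQ
      · rw [degree_mul, degree_mul]
        exact WithBot.add_lt_add_right (by simpa using hQ) (degree_derivative_lt hP)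
    · rw [degree_mul, degree_mul]
      exact WithBot.add_lt_add_left (by simpa using hP) (degree_derivative_lt hQ)
  rw [sub_eq_zero.mp h] at hlt
  exact lt_irrefl _ hlt

theorem natDegree_self_sub_derivative_numerator_le (P Q : ℂ[X]) :
    (P * Q - (derivative P * Q - P * derivative Q)).natDegree ≤
      P.natDegree + Q.natDegree := by
  have hP := natDegree_derivative_le P
  have hQ := natDegree_derivative_le Q
  refine (natDegree_sub_le _ _).trans (max_le natDegree_mul_le ?_)
  refine (natDegree_sub_le _ _).trans (max_le ?_ ?_) <;>
    refine natDegree_mul_le.trans ?_ <;> omega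

/-- Two members of the pencil spanned by `P` and `Q` cannot both drop in degree. -/
theorem max_natDegree_lt_of_pencil {P Q : ℂ[X]} {a b : ℂ} (hab : a ≠ b) {d : ℕ}
    (ha : (P - C a * Q).natDegree < d) (hb : (P - C b * Q).natDegree < d) :
    max P.natDegree Q.natDegree < d := by
  have hba : b - a ≠ 0 := sub_ne_zero.mpr hab.symm
  have hQ : Q.natDegree < d := by
    have h : C (b - a) * Q = (P - C a * Q) - (P - C b * Q) := by
      rw [C_sub]; ring
    rw [← natDegree_C_mul hba, h]
    exact (natDegree_sub_le _ _).trans_lt (max_lt ha hb)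
  refine max_lt ?_ hQ
  have h : P = (P - C a * Q) + C a * Q := by ring
  rw [h]
  exact (natDegree_add_le _ _).trans_lt
    (max_lt ha ((natDegree_C_mul_le a Q).trans_lt hQ))

/-- Four counts, each equal to `d` apart from at most one that is merely positive and at most
one arbitrary, add up to more than `2 * d`. -/
theorem two_mul_lt_sum_fin_four {n : Fin 4 → ℕ} {d : ℕ} (hd : 0 < d) {Z D : Fin 4 → Prop}
    (h : ∀ k, n k = d ∨ (Z k ∧ 0 < n k) ∨ D k)
    (hZ : ∀ i j, i ≠ j → Z i → ¬ Z j) (hD : ∀ i j, i ≠ j → D i → ¬ D j) :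
    2 * d < ∑ k, n k := by
  rw [Fin.sum_univ_four]
  grind

theorem eval_ne_zero_of_isCoprime_of_isRoot {P Q : ℂ[X]} (hcop : IsCoprime P Q) {a z : ℂ}
    (hz : (P - C a * Q).IsRoot z) : Q.eval z ≠ 0 := by
  intro hQz
  have hPz : P.eval z = 0 := by simpa [hQz] using hz
  obtain ⟨u, v, huv⟩ := hcop
  simpa [hPz, hQz] using congrArg (eval z) huv

theorem deriv_eval_div_eval (P Q : ℂ[X]) {z : ℂ} (hz : Q.eval z ≠ 0) :
    deriv (fun w : ℂ => P.eval w / Q.eval w) z =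
      ((derivative P).eval z * Q.eval z - P.eval z * (derivative Q).eval z) / Q.eval z ^ 2 :=
  ((P.hasDerivAt z).div (Q.hasDerivAt z) hz).deriv

/-- No nonconstant rational function partially shares four pairwise distinct finite
values with its derivative. -/
theorem no_rational_partially_shares_four_values
    (P Q : Polynomial ℂ) (hcop : IsCoprime P Q) (hQ : Q ≠ 0)
    (hnonconst : ¬ ∃ c : ℂ, ∀ z : ℂ, Q.eval z ≠ 0 → P.eval z / Q.eval z = c)
    (a : Fin 4 → ℂ) (hinj : Function.Injective a) :
    ¬ ∀ (k : Fin 4) (z : ℂ), Q.eval z ≠ 0 → P.eval z / Q.eval z = a k →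
        deriv (fun w : ℂ => P.eval w / Q.eval w) z = a k := by
  intro hshare
  have hne (c : ℂ) : P - C c * Q ≠ 0 := fun h => hnonconst ⟨c, fun z hz => by
    rw [sub_eq_zero.mp h, eval_mul, eval_C, mul_div_cancel_right₀ _ hz]⟩
  have hP : P ≠ 0 := by simpa using hne 0
  set d := max P.natDegree Q.natDegree with hd_def
  have hd : 0 < d := by
    by_contra h
    have hPd : P.natDegree = 0 := by omega
    have hQd : Q.natDegree = 0 := by omega
    refine hnonconst ⟨P.coeff 0 / Q.coeff 0, fun z _ => ?_⟩
    rw [eq_C_of_natDegree_eq_zero hPd, eq_C_of_natDegree_eq_zero hQd]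
    simp
  have hroot {k : Fin 4} {z : ℂ} (hz : (P - C (a k) * Q).IsRoot z) :
      Q.eval z ≠ 0 ∧ P.eval z = a k * Q.eval z ∧
        (derivative P).eval z - a k * (derivative Q).eval z = a k * Q.eval z := by
    have hQz := eval_ne_zero_of_isCoprime_of_isRoot hcop hz
    have hPz : P.eval z = a k * Q.eval z := by
      simpa [sub_eq_zero] using hz
    have h := hshare k z hQz (by rw [hPz, mul_div_cancel_right₀ _ hQz])
    rw [deriv_eval_div_eval P Q hQz, div_eq_iff (pow_ne_zero 2 hQz), hPz] at h
    exact ⟨hQz, hPz, mul_right_cancel₀ hQz (by linear_combination h)⟩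
  set M := P * Q - (derivative P * Q - P * derivative Q) with hM_def
  have hM : M ≠ 0 := self_sub_derivative_numerator_ne_zero hP hQ
  let S : Fin 4 → Finset ℂ := fun k => (P - C (a k) * Q).roots.toFinset
  have hmem {k : Fin 4} {z : ℂ} (hz : z ∈ S k) : (P - C (a k) * Q).IsRoot z :=
    isRoot_of_mem_roots (Multiset.mem_toFinset.mp hz)
  have hcard_le : ∑ k, (S k).card ≤ 2 * d := by
    have hdisj : (↑(Finset.univ : Finset (Fin 4)) : Set (Fin 4)).PairwiseDisjoint S := by
      intro i _ j _ hij
      refine Finset.disjoint_left.mpr fun z hi hj => hij (hinj ?_)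
      obtain ⟨hQz, hi', -⟩ := hroot (hmem hi)
      obtain ⟨-, hj', -⟩ := hroot (hmem hj)
      exact mul_right_cancel₀ hQz (hi'.symm.trans hj')
    rw [← Finset.card_biUnion hdisj]
    have hsub : Finset.univ.biUnion S ⊆ M.roots.toFinset := by
      intro z hz
      obtain ⟨k, -, hk⟩ := Finset.mem_biUnion.mp hz
      obtain ⟨-, hPz, hder⟩ := hroot (hmem hk)
      rw [Multiset.mem_toFinset, mem_roots hM, IsRoot.def]
      simp only [hM_def, eval_sub, eval_mul, hPz]
      linear_combination -(Q.eval z) * hder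
    calc (Finset.univ.biUnion S).card ≤ M.roots.toFinset.card := Finset.card_le_card hsub
      _ ≤ M.roots.card := Multiset.toFinset_card_le _
      _ ≤ M.natDegree := card_roots' M
      _ ≤ P.natDegree + Q.natDegree := natDegree_self_sub_derivative_numerator_le P Q
      _ ≤ 2 * d := by omega
  refine hcard_le.not_gt (two_mul_lt_sum_fin_four hd (Z := fun k => a k = 0)
    (D := fun k => (P - C (a k) * Q).natDegree < d) (fun k => ?_) ?_ ?_)
  · rcases lt_or_ge (P - C (a k) * Q).natDegree d with hlt | hge
    · exact Or.inr (Or.inr hlt)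
    have hdeg : (P - C (a k) * Q).natDegree = d :=
      le_antisymm ((natDegree_sub_le _ _).trans
        (max_le_max le_rfl (natDegree_C_mul_le _ _))) hge
    by_cases hk : a k = 0
    · refine Or.inr (Or.inl ⟨hk, Finset.card_pos.mpr ?_⟩)
      obtain ⟨z, hz⟩ := Complex.exists_root (natDegree_pos_iff_degree_pos.mp (hdeg ▸ hd))
      exact ⟨z, Multiset.mem_toFinset.mpr ((mem_roots (hne _)).mpr hz)⟩
    · left
      have hnodup : (P - C (a k) * Q).roots.Nodup := by
        refine Multiset.nodup_iff_count_le_one.mpr fun z => ?_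
        rw [count_roots]
        by_contra hlt
        obtain ⟨hz, hz'⟩ := (one_lt_rootMultiplicity_iff_isRoot (hne _)).mp (not_le.mp hlt)
        obtain ⟨hQz, -, hder⟩ := hroot hz
        refine mul_ne_zero hk hQz (hder.symm.trans ?_)
        simpa using hz'
      rw [Multiset.toFinset_card_of_nodup hnodup,
        ← (IsAlgClosed.splits (P - C (a k) * Q)).natDegree_eq_card_roots, hdeg]
  · exact fun i j hij hi hj => hij (hinj (hi.trans hj.symm))
  · exact fun i j hij hi hj => lt_irrefl d (max_natDegree_lt_of_pencil (hinj.ne hij) hi hj)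
end

section
/- There is no nonconstant rational function, all of whose poles are multiple, that partially shares three pairwise distinct finite values with its derivative. Precisely: let P, Q be coprime polynomials over ℂ with Q ≠ 0 and P/Q nonconstant, suppose every root of Q has multiplicity at least 2, let f(z) = P(z)/Q(z) (defined for z with Q(z) ≠ 0), and let a₁, a₂, a₃ be pairwise distinct complex numbers. Then it cannot happen that for all k = 1,2,3 and all z ∈ ℂ with Q(z) ≠ 0, f(z) = aₖ implies f'(z) = aₖ. -/
open Polynomial in
/-- A separable complex polynomial divides every polynomial vanishing at its roots. -/
theorem Polynomial.Separable.dvd_of_forall_eval_eq_zero {p r : Polynomial ℂ} (hp : p.Separable)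
    (h : ∀ z, p.eval z = 0 → r.eval z = 0) : p ∣ r := by
  rcases eq_or_ne r 0 with rfl | hr
  · exact dvd_zero p
  refine (IsAlgClosed.splits p).dvd_of_roots_le_roots hp.ne_zero ?_
  rw [Multiset.le_iff_subset (nodup_roots hp)]
  intro z hz
  exact (mem_roots hr).2 (h z (isRoot_of_mem_roots hz))

open Polynomial UniqueFactorizationMonoid in
theorem separable_radical (p : Polynomial ℂ) : (radical p).Separable :=
  PerfectField.separable_iff_squarefree.2 squarefree_radical

open Polynomial in
/-- A complex polynomial without a common root with its derivative is separable. -/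
theorem Polynomial.separable_of_forall_eval_derivative_ne_zero {p : Polynomial ℂ}
    (h : ∀ z, p.eval z = 0 → p.derivative.eval z ≠ 0) : p.Separable := by
  refine (isCoprime_iff_aeval_ne_zero_of_isAlgClosed _ ℂ _ _).2 fun z => ?_
  simpa only [coe_aeval_eq_eval, or_iff_not_imp_left, not_not] using h z

open Polynomial UniqueFactorizationMonoid EuclideanDomain in
/-- If all roots of `Q` are multiple, then `Q` has at most `Q.natDegree / 2` distinct roots. -/
theorem two_mul_natDegree_radical_le {Q : Polynomial ℂ} (hQ : Q ≠ 0)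
    (hmult : ∀ z, Q.eval z = 0 → 2 ≤ Q.rootMultiplicity z) :
    2 * (radical Q).natDegree ≤ Q.natDegree := by
  have hD : divRadical Q ≠ 0 := divRadical_ne_zero hQ
  have hdvd : radical Q ∣ divRadical Q := by
    refine (separable_radical Q).dvd_of_forall_eval_eq_zero fun z hz => ?_
    by_contra hne
    have hQz : Q.eval z = 0 := by
      rw [← radical_mul_divRadical (a := Q), eval_mul, hz, zero_mul]
    have h2 := hmult z hQz
    rw [← radical_mul_divRadical (a := Q), rootMultiplicity_mul
      (mul_ne_zero radical_ne_zero hD), rootMultiplicity_eq_zero (p := divRadical Q) hne] at h2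
    have h1 := rootMultiplicity_le_one_of_separable (separable_radical Q) z
    omega
  have hle := natDegree_le_of_dvd hdvd hD
  have hadd := natDegree_mul (p := radical Q) radical_ne_zero hD
  rw [radical_mul_divRadical] at hadd
  omega

open Polynomial in
theorem degree_derivative_mul_sub_mul_lt {A U T : Polynomial ℂ} (hA : A ≠ 0)
    (hT : T.degree < U.degree) :
    (derivative A * U - A * T).degree < (A * U).degree := by
  have hU : U ≠ 0 := by
    rintro rfl
    simp at hT
  refine (degree_sub_le _ _).trans_lt (max_lt ?_ ?_)
  · rw [degree_mul, degree_mul]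
    exact WithBot.add_lt_add_right (degree_ne_bot.2 hU) (degree_derivative_lt hA)
  · rw [degree_mul, degree_mul]
    exact WithBot.add_lt_add_left (degree_ne_bot.2 hA) hT

open Polynomial UniqueFactorizationMonoid EuclideanDomain in
/-- If `P / Q` has only multiple poles and takes the nonzero values `a`, `b` and the value `c`
only where its derivative takes the same value, then `P / Q` is constant. -/
theorem wronskian_eq_zero_of_shares {P Q : Polynomial ℂ} (hcop : IsCoprime P Q) (hP : P ≠ 0)
    (hQ : Q ≠ 0) (hmult : ∀ z, Q.eval z = 0 → 2 ≤ Q.rootMultiplicity z) {a b c : ℂ}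
    (ha : a ≠ 0) (hb : b ≠ 0) (hab : a ≠ b) (hac : a ≠ c) (hbc : b ≠ c)
    (hshare : ∀ d, d = a ∨ d = b ∨ d = c → ∀ z, (P - C d * Q).eval z = 0 →
      (derivative P * Q - P * derivative Q).eval z = d * Q.eval z ^ 2) :
    derivative P * Q - P * derivative Q = 0 := by
  by_contra hW
  obtain ⟨T, hT⟩ := divRadical_dvd_derivative Q
  have hQD : radical Q * divRadical Q = Q := radical_mul_divRadical
  have h2 := two_mul_natDegree_radical_le hQ hmult
  have hU : radical Q ≠ 0 := radical_ne_zero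
  have hD : divRadical Q ≠ 0 := divRadical_ne_zero hQ
  generalize radical Q = U at *
  generalize divRadical Q = D at *
  have hTU : T.degree < U.degree := by
    have h := degree_derivative_lt hQ
    rw [hT, ← hQD, mul_comm U, degree_mul, degree_mul] at h
    exact lt_of_add_lt_add_left h
  -- `S / (Q * U)` is the derivative of `P / Q`
  set S := derivative P * U - P * T with hS
  have hSD : S * D = derivative P * Q - P * derivative Q := by
    rw [hS, hT, ← hQD]; ring
  have hS0 : S ≠ 0 := by
    intro h
    rw [h, zero_mul] at hSD
    exact hW hSD.symm
  have hSd (d : ℂ) : S = derivative (P - C d * Q) * U - (P - C d * Q) * T := by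
    have : derivative Q * U = Q * T := by rw [hT, ← hQD]; ring
    simp only [derivative_sub, derivative_C_mul, hS]
    linear_combination C d * this
  have hne (d : ℂ) : P - C d * Q ≠ 0 := by
    intro h
    apply hS0
    rw [hSd d, h]
    simp
  have hSdeg (d : ℂ) : S.natDegree < (P - C d * Q).natDegree + U.natDegree := by
    rw [← natDegree_mul (hne d) hU]
    refine natDegree_lt_natDegree hS0 ?_
    rw [hSd d]
    exact degree_derivative_mul_sub_mul_lt (hne d) hTU
  have hlt : S.degree < (P * U).degree := degree_derivative_mul_sub_mul_lt hP hTU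
  -- `R / (Q * U)` is the derivative of `P / Q` minus `P / Q`
  set R := S - P * U with hR
  have hRdeg : R.degree = (P * U).degree := degree_sub_eq_right_of_degree_lt hlt
  have hR0 : R ≠ 0 := by
    intro h
    rw [h, degree_zero, eq_comm, degree_eq_bot] at hRdeg
    exact mul_ne_zero hP hU hRdeg
  have hRnat : R.natDegree = P.natDegree + U.natDegree := by
    rw [natDegree_eq_of_degree_eq hRdeg, natDegree_mul hP hU]
  have hcopQ (d : ℂ) : IsCoprime (P - C d * Q) Q := by
    have := hcop.add_mul_right_left (-C d)
    rwa [neg_mul, ← sub_eq_add_neg] at this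
  have hcopd {d e : ℂ} (hde : d ≠ e) : IsCoprime (P - C d * Q) (P - C e * Q) := by
    have hu : IsUnit (C (d - e)) := isUnit_C.2 (sub_ne_zero.2 hde).isUnit
    have h : IsCoprime (P - C d * Q) (C (d - e) * Q) :=
      (isCoprime_mul_unit_left_right hu _ _).2 (hcopQ d)
    have heq : P - C e * Q = C (d - e) * Q + (P - C d * Q) * 1 := by
      rw [C_sub]; ring
    rw [heq]
    exact h.add_mul_left_right 1
  have hQz {d z : ℂ} (hz : (P - C d * Q).eval z = 0) : Q.eval z ≠ 0 := by
    intro h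
    obtain ⟨u, v, huv⟩ := hcopQ d
    have := congrArg (eval z) huv
    simp only [eval_add, eval_mul, hz, h, mul_zero, add_zero, eval_one] at this
    exact zero_ne_one this
  have hRz {d : ℂ} (hd : d = a ∨ d = b ∨ d = c) {z : ℂ} (hz : (P - C d * Q).eval z = 0) :
      R.eval z = 0 := by
    have hRD : R * D = (derivative P * Q - P * derivative Q) - P * Q := by
      rw [← hSD, hR, ← hQD]; ring
    have h := congrArg (eval z) hRD
    rw [eval_mul, eval_sub (p := derivative P * Q - P * derivative Q), hshare d hd z hz,
      eval_mul] at h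
    have hDz : D.eval z ≠ 0 := by
      intro h0
      apply hQz hz
      rw [← hQD, eval_mul, h0, mul_zero]
    refine (mul_eq_zero.1 (h.trans ?_)).resolve_right hDz
    simp only [eval_sub, eval_mul, eval_C] at hz
    linear_combination -Q.eval z * hz
  have hsep {d : ℂ} (hd : d = a ∨ d = b ∨ d = c) (hd0 : d ≠ 0) : (P - C d * Q).Separable := by
    refine separable_of_forall_eval_derivative_ne_zero fun z hz h0 => ?_
    have h := hshare d hd z hz
    have hQ0 := hQz hz
    simp only [eval_sub, eval_mul, eval_C, derivative_sub, derivative_C_mul] at h hz h0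
    have : d * Q.eval z ^ 2 = 0 := by
      linear_combination -h + Q.eval z * h0 - (derivative Q).eval z * hz
    exact mul_ne_zero hd0 (pow_ne_zero 2 hQ0) this
  have hAR : P - C a * Q ∣ R :=
    (hsep (by simp) ha).dvd_of_forall_eval_eq_zero fun z => hRz (by simp)
  have hBR : P - C b * Q ∣ R :=
    (hsep (by simp) hb).dvd_of_forall_eval_eq_zero fun z => hRz (by simp)
  have hCrad : radical (P - C c * Q) ∣ P - C c * Q := radical_dvd_self
  have hCR : radical (P - C c * Q) ∣ R :=
    (separable_radical _).dvd_of_forall_eval_eq_zero fun z hz =>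
      hRz (d := c) (by simp) (eval_eq_zero_of_dvd_of_eval_eq_zero hCrad hz)
  have hprod : (P - C a * Q) * (P - C b * Q) * radical (P - C c * Q) ∣ R := by
    refine IsCoprime.mul_dvd ?_ ((hcopd hab).mul_dvd hAR hBR) hCR
    exact ((hcopd hac).mul_left (hcopd hbc)).of_isCoprime_of_dvd_right hCrad
  have hsum := natDegree_le_of_dvd hprod hR0
  rw [natDegree_mul (mul_ne_zero (hne a) (hne b)) radical_ne_zero,
    natDegree_mul (hne a) (hne b), hRnat] at hsum
  have hE : divRadical (P - C c * Q) ∣ S := by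
    rw [hSd c]
    exact dvd_sub ((divRadical_dvd_derivative _).mul_right _) ((divRadical_dvd_self _).mul_right _)
  have hEdeg := natDegree_le_of_dvd hE hS0
  have hγ := natDegree_mul (p := radical (P - C c * Q)) radical_ne_zero
    (divRadical_ne_zero (hne c))
  rw [radical_mul_divRadical] at hγ
  have hSa := hSdeg a
  have hSb := hSdeg b
  have hdrop {d e : ℂ} (hde : d ≠ e) (h : (P - C d * Q).natDegree < Q.natDegree) :
      (P - C e * Q).natDegree = Q.natDegree := by
    have heq : P - C e * Q = (P - C d * Q) + C (d - e) * Q := by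
      rw [C_sub]; ring
    have hdeg := natDegree_C_mul (p := Q) (sub_ne_zero.2 hde)
    rw [heq, natDegree_add_eq_right_of_natDegree_lt (by rwa [hdeg]), hdeg]
  have hCa := natDegree_C_mul (p := Q) ha
  have hCb := natDegree_C_mul (p := Q) hb
  rcases lt_trichotomy P.natDegree Q.natDegree with h | h | h
  · have h1 := natDegree_sub_eq_right_of_natDegree_lt (h.trans_eq hCa.symm)
    have h2 := natDegree_sub_eq_right_of_natDegree_lt (h.trans_eq hCb.symm)
    omega
  · rcases lt_or_ge (P - C a * Q).natDegree Q.natDegree with h1 | h1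
    · have h2 := hdrop hab h1
      have h3 := hdrop hac h1
      omega
    · rcases lt_or_ge (P - C b * Q).natDegree Q.natDegree with h2 | h2
      · have h3 := hdrop hbc h2
        have h4 := hdrop hab.symm h2
        omega
      · have := natDegree_sub_le P (C a * Q)
        omega
  · have h1 := natDegree_sub_eq_left_of_natDegree_lt (hCa.trans_lt h)
    have h2 := natDegree_sub_eq_left_of_natDegree_lt (hCb.trans_lt h)
    omega

/-- Among three distinct complex numbers, two are nonzero. -/
theorem exists_two_ne_zero_of_injective {a : Fin 3 → ℂ} (hinj : Function.Injective a) :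
    ∃ i j k : Fin 3, a i ≠ 0 ∧ a j ≠ 0 ∧ i ≠ j ∧ i ≠ k ∧ j ≠ k := by
  by_cases h0 : a 0 = 0
  · exact ⟨1, 2, 0, fun h => absurd (hinj (h.trans h0.symm)) (by decide),
      fun h => absurd (hinj (h.trans h0.symm)) (by decide), by decide, by decide, by decide⟩
  by_cases h1 : a 1 = 0
  · exact ⟨0, 2, 1, h0, fun h => absurd (hinj (h.trans h1.symm)) (by decide),
      by decide, by decide, by decide⟩
  · exact ⟨0, 1, 2, h0, h1, by decide, by decide, by decide⟩

/-- No nonconstant rational function all of whose poles are multiple partially shares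
three pairwise distinct finite values with its derivative. -/
theorem no_rational_multiple_poles_partially_shares_three_values
    (P Q : Polynomial ℂ) (hcop : IsCoprime P Q) (hQ : Q ≠ 0)
    (hnonconst : ¬ ∃ c : ℂ, ∀ z : ℂ, Q.eval z ≠ 0 → P.eval z / Q.eval z = c)
    (hmult : ∀ z : ℂ, Q.eval z = 0 → 2 ≤ Q.rootMultiplicity z)
    (a : Fin 3 → ℂ) (hinj : Function.Injective a) :
    ¬ ∀ (k : Fin 3) (z : ℂ), Q.eval z ≠ 0 → P.eval z / Q.eval z = a k →
        deriv (fun w : ℂ => P.eval w / Q.eval w) z = a k := by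
  intro hshare
  obtain ⟨i, j, k, hi, hj, hij, hik, hjk⟩ := exists_two_ne_zero_of_injective hinj
  have hP : P ≠ 0 := by
    rintro rfl
    exact hnonconst ⟨0, by simp⟩
  have hvalue (m : Fin 3) (z : ℂ) (hz : (P - Polynomial.C (a m) * Q).eval z = 0) :
      (P.derivative * Q - P * Q.derivative).eval z = a m * Q.eval z ^ 2 := by
    simp only [Polynomial.eval_sub, Polynomial.eval_mul, Polynomial.eval_C] at hz ⊢
    have hQz : Q.eval z ≠ 0 := by
      intro h
      obtain ⟨u, v, huv⟩ := hcop
      rw [h, mul_zero, sub_zero] at hz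
      have := congrArg (Polynomial.eval z) huv
      simp [hz, h] at this
    have h := hshare m z hQz ((div_eq_iff hQz).2 (sub_eq_zero.1 hz))
    have hd := ((P.hasDerivAt z).div (Q.hasDerivAt z) hQz).deriv
    exact (div_eq_iff (pow_ne_zero 2 hQz)).1 (hd.symm.trans h)
  have hW := wronskian_eq_zero_of_shares hcop hP hQ hmult hi hj (hinj.ne hij) (hinj.ne hik)
    (hinj.ne hjk) (by rintro d (rfl | rfl | rfl) <;> exact hvalue _)
  have hw : Polynomial.wronskian P Q = 0 := by
    rw [Polynomial.wronskian, ← neg_eq_zero, neg_sub, hW]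
  obtain ⟨hP', hQ'⟩ := hcop.wronskian_eq_zero_iff.1 hw
  rw [Polynomial.eq_C_of_derivative_eq_zero hP', Polynomial.eq_C_of_derivative_eq_zero hQ']
    at hnonconst
  exact hnonconst ⟨P.coeff 0 / Q.coeff 0, by simp⟩
end

section
/- Define R(w) = (18w² + 18w + 5)/(18w² + 36w + 20) and f(z) = R(e^{z/6}) for z ∈ ℂ (at points where the denominator is nonzero). Then f is a nonconstant meromorphic function on ℂ with f ≢ f', and f partially shares each of the three pairwise distinct nonzero values 1, 1/4, and −1/2 with its derivative f'. (Thus three partially shared values do not force f ≡ f' for meromorphic functions, even though here f = R(e^{λz}) with R of degree two.) -/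
/-- The derivative of `z ↦ R(e^{z/6})` away from its poles, by the quotient rule. -/
lemma hasDerivAt_rational_exp_div_six (z : ℂ)
    (hz : 18 * Complex.exp (z / 6) ^ 2 + 36 * Complex.exp (z / 6) + 20 ≠ 0) :
    HasDerivAt (fun z : ℂ =>
      (18 * Complex.exp (z / 6) ^ 2 + 18 * Complex.exp (z / 6) + 5) /
      (18 * Complex.exp (z / 6) ^ 2 + 36 * Complex.exp (z / 6) + 20))
      (Complex.exp (z / 6) / 6 *
        ((36 * Complex.exp (z / 6) + 18) *
            (18 * Complex.exp (z / 6) ^ 2 + 36 * Complex.exp (z / 6) + 20) -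
          (18 * Complex.exp (z / 6) ^ 2 + 18 * Complex.exp (z / 6) + 5) *
            (36 * Complex.exp (z / 6) + 36)) /
        (18 * Complex.exp (z / 6) ^ 2 + 36 * Complex.exp (z / 6) + 20) ^ 2) z := by
  have he : HasDerivAt (fun z : ℂ => Complex.exp (z / 6)) (Complex.exp (z / 6) * (1 / 6)) z :=
    ((hasDerivAt_id z).div_const 6).cexp
  have hquad (b c : ℂ) := (((he.pow 2).const_mul 18).add (he.const_mul b)).add_const c
  refine ((hquad 18 5).div (hquad 36 20) hz).congr_deriv ?_
  simp only [Pi.add_apply, Pi.pow_apply]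
  congr 1
  push_cast
  ring

/-- **Example.** With `R(w) = (18w² + 18w + 5)/(18w² + 36w + 20)`, the function
`f(z) = R(e^{z/6})` is a nonconstant meromorphic function with `f ≢ f'` that partially
shares each of the three pairwise distinct nonzero values `1`, `1/4` and `-1/2` with
its derivative `f'`. -/
theorem example_three_partially_shared_values :
    let f : ℂ → ℂ := fun z =>
      (18 * Complex.exp (z / 6) ^ 2 + 18 * Complex.exp (z / 6) + 5) /
      (18 * Complex.exp (z / 6) ^ 2 + 36 * Complex.exp (z / 6) + 20)
    (∀ z : ℂ, MeromorphicAt f z) ∧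
    (¬ ∃ c : ℂ, ∀ z : ℂ, AnalyticAt ℂ f z → f z = c) ∧
    (¬ ∀ z : ℂ, AnalyticAt ℂ f z → deriv f z = f z) ∧
    (∀ z : ℂ, AnalyticAt ℂ f z → f z = 1 → deriv f z = 1) ∧
    (∀ z : ℂ, AnalyticAt ℂ f z → f z = 1 / 4 → deriv f z = 1 / 4) ∧
    (∀ z : ℂ, AnalyticAt ℂ f z → f z = -1 / 2 → deriv f z = -1 / 2) := by
  intro f
  have hderiv (z : ℂ)
      (hz : 18 * Complex.exp (z / 6) ^ 2 + 36 * Complex.exp (z / 6) + 20 ≠ 0) :=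
    (hasDerivAt_rational_exp_div_six z hz).deriv
  have hanalytic (z : ℂ)
      (hz : 18 * Complex.exp (z / 6) ^ 2 + 36 * Complex.exp (z / 6) + 20 ≠ 0) :
      AnalyticAt ℂ f z := by
    simp only [f]
    fun_prop (disch := assumption)
  have hden (z : ℂ) (hf : f z ≠ 0) :
      18 * Complex.exp (z / 6) ^ 2 + 36 * Complex.exp (z / 6) + 20 ≠ 0 :=
    (div_ne_zero_iff.mp hf).2
  have hzero : AnalyticAt ℂ f 0 := hanalytic 0 (by norm_num)
  refine ⟨fun z => ?_, ?_, fun h => ?_, fun z _ h => ?_, fun z _ h => ?_, fun z _ h => ?_⟩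
  · simp only [f]
    exact AnalyticAt.meromorphicAt (by fun_prop) |>.div
      (AnalyticAt.meromorphicAt (by fun_prop))
  · rintro ⟨c, hc⟩
    have hexp : Complex.exp (6 * Complex.log (-5 / 6) / 6) = -5 / 6 := by
      rw [mul_div_cancel_left₀ _ (by norm_num), Complex.exp_log (by norm_num)]
    have h₁ := hc (6 * Complex.log (-5 / 6)) (hanalytic _ (by rw [hexp]; norm_num))
    have h₀ := hc 0 hzero
    rw [← h₁] at h₀
    simp only [f, hexp] at h₀
    norm_num at h₀
  · have h₀ := h 0 hzero
    rw [hderiv 0 (by norm_num)] at h₀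
    norm_num [f] at h₀
  · have hD := hden z (by rw [h]; norm_num)
    rw [hderiv z hD]
    simp only [f] at h
    rw [div_eq_iff hD] at h
    have hw : Complex.exp (z / 6) = -5 / 6 := by linear_combination -h / 18
    rw [hw]
    norm_num
  · have hD := hden z (by rw [h]; norm_num)
    rw [hderiv z hD]
    simp only [f] at h
    rw [div_eq_iff hD] at h
    have hw : Complex.exp (z / 6) = -2 / 3 :=
      mul_left_cancel₀ (Complex.exp_ne_zero (z / 6)) (by linear_combination 2 / 27 * h)
    rw [hw]
    norm_num
  · have hD := hden z (by rw [h]; norm_num)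
    rw [hderiv z hD]
    simp only [f] at h
    rw [div_eq_iff hD] at h
    rw [h, div_eq_iff (pow_ne_zero 2 hD)]
    generalize Complex.exp (z / 6) = w at *
    linear_combination (2 / 3 * (18 * w ^ 2 + 36 * w + 20)) * h
end
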